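/- arXiv:math/0305131 — 4 statements merged into one kernel-verified Lean document; each statement's English description precedes it below -/
import Mathlib

section
/- For every real q > 0, ∫_0^∞ t / ((1+t²)(e^{2πqt} − 1)) dt = (1/2) ln q − 1/(4q) − (1/2) ψ(q), where ψ is the digamma function. -/
open Real MeasureTheory

open Filter Set Topology

lemma integrableOn_id_mul_exp_neg_mul_Ioi {a : ℝ} (ha : 0 < a) :
    IntegrableOn (fun x : ℝ ↦ x * exp (-(a * x))) (Ioi 0) := by
  have h := integrableOn_rpow_mul_exp_neg_mul_rpow (s := 1) (p := 1) (b := a)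
    (by norm_num) one_pos ha
  simpa [neg_mul] using h

lemma integral_id_mul_exp_neg_mul_Ioi {a : ℝ} (ha : 0 < a) :
    ∫ x in Ioi (0 : ℝ), x * exp (-(a * x)) = 1 / a ^ 2 := by
  have h := integral_rpow_mul_exp_neg_mul_Ioi (a := 2) two_pos ha
  rw [Real.Gamma_two] at h
  norm_num at h
  simpa using h

lemma integrableOn_exp_neg_mul_Ioi {a : ℝ} (ha : 0 < a) :
    IntegrableOn (fun x : ℝ ↦ exp (-(a * x))) (Ioi 0) := by
  simpa [neg_mul] using integrableOn_exp_mul_Ioi (neg_lt_zero.2 ha) 0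

lemma integral_exp_neg_mul_Ioi {a : ℝ} (ha : 0 < a) :
    ∫ x in Ioi (0 : ℝ), exp (-(a * x)) = 1 / a := by
  simpa [neg_mul] using integral_exp_mul_Ioi (neg_lt_zero.2 ha) 0

/-- The Laplace transform of the sine function. -/
lemma integral_sin_mul_exp_neg_mul_Ioi {a : ℝ} (ha : 0 < a) (b : ℝ) :
    ∫ x in Ioi (0 : ℝ), sin (b * x) * exp (-(a * x)) = b / (a ^ 2 + b ^ 2) := by
  have hre : ((-a + b * Complex.I : ℂ)).re < 0 := by simpa using ha
  have h := integral_exp_mul_complex_Ioi hre 0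
  have h2 := congrArg Complex.im h
  have h3 := integral_im (𝕜 := ℂ) (integrableOn_exp_mul_complex_Ioi hre 0)
  simp only [RCLike.im_to_complex] at h3
  rw [← h3] at h2
  have e : ∀ x : ℝ, (Complex.exp ((-a + b * Complex.I : ℂ) * x)).im
      = sin (b * x) * exp (-(a * x)) := by
    intro x
    simp [Complex.exp_im, mul_comm]
  simp_rw [e] at h2
  rw [h2]
  simp [Complex.div_im, Complex.normSq_apply]
  ring

lemma hasSum_exp_neg_two_pi_mul {u : ℝ} (hu : 0 < u) :
    HasSum (fun n : ℕ ↦ exp (-(2 * π * (n + 1) * u))) (1 / (exp (2 * π * u) - 1)) := by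
  have hpos : 0 < 2 * π * u := by positivity
  have h := (hasSum_geometric_of_lt_one (exp_pos (-(2 * π * u))).le
    (by simpa using hpos)).mul_left (exp (-(2 * π * u)))
  have h1 : 1 < exp (2 * π * u) := one_lt_exp_iff.2 hpos
  convert! h using 1
  · ext n
    rw [← exp_nat_mul, ← exp_add]
    ring_nf
  · rw [exp_neg]
    have : exp (2 * π * u) - 1 ≠ 0 := by linarith
    field_simp

lemma mul_exp_pi_mul_le {u : ℝ} (hu : 0 ≤ u) :
    u * exp (π * u) ≤ exp (2 * π * u) - 1 := by
  have h1 : π * u + 1 ≤ exp (π * u) := add_one_le_exp _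
  have h2 : exp (2 * π * u) = exp (π * u) * exp (π * u) := by
    rw [← exp_add]; ring_nf
  have h3 : u ≤ π * u := by nlinarith [pi_gt_three]
  nlinarith [exp_pos (π * u)]

lemma hasSum_div_add_sq {x : ℝ} (hx : 0 < x) :
    HasSum (fun n : ℕ ↦ x / ((2 * π * (n + 1)) ^ 2 + x ^ 2))
      ((1 + exp (-x)) / (4 * (1 - exp (-x))) - 1 / (2 * x)) := by
  set z : ℂ := ((x / (2 * π) : ℝ) : ℂ) * Complex.I with hz
  have hzim : 0 < z.im := by
    simp only [hz, Complex.im_ofReal_mul, Complex.I_im]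
    positivity
  have hmem : z ∈ Complex.integerComplement :=
    UpperHalfPlane.coe_mem_integerComplement ⟨z, hzim⟩
  have hs := (summable_cotTerm hmem).hasSum
  have hrep := cot_series_rep' hmem
  unfold cotTerm at hs
  rw [← hrep, Complex.cot_pi_eq_exp_ratio] at hs
  have hexp : Complex.exp (2 * π * Complex.I * z) = ((exp (-x) : ℝ) : ℂ) := by
    rw [Complex.ofReal_exp, hz]
    congr 1
    push_cast
    have : (π : ℂ) ≠ 0 := by exact_mod_cast pi_ne_zero
    field_simp
    rw [Complex.I_sq]
    ring
  rw [hexp] at hs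
  have hs2 := hs.mul_left (Complex.I / (4 * π))
  rw [← Complex.hasSum_ofReal]
  have hpi : (π : ℂ) ≠ 0 := by exact_mod_cast pi_ne_zero
  have hxc : (x : ℂ) ≠ 0 := by exact_mod_cast hx.ne'
  have he : (1 - (exp (-x) : ℝ) : ℂ) ≠ 0 := by
    have : exp (-x) < 1 := by simpa using hx
    exact_mod_cast (sub_pos.2 this).ne'
  convert! hs2 using 1
  · ext n
    have hn1 : z - (n + 1) ≠ 0 := by
      intro h
      have := congrArg Complex.im h
      simp at this
      exact hzim.ne' this
    have hn2 : z + (n + 1) ≠ 0 := by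
      intro h
      have := congrArg Complex.im h
      simp at this
      exact hzim.ne' this
    have hn3 : ((2 * π * (n + 1)) ^ 2 + x ^ 2 : ℂ) ≠ 0 := by
      have : 0 < (2 * π * (n + 1)) ^ 2 + x ^ 2 := by positivity
      exact_mod_cast this.ne'
    have hkey : ((2 * π * (n + 1)) ^ 2 + x ^ 2 : ℂ) =
        -(4 * π ^ 2) * ((z - (n + 1)) * (z + (n + 1))) := by
      rw [hz]
      push_cast
      field_simp
      ring_nf
      rw [Complex.I_sq]
      ring
    have hxz : (x : ℂ) = -2 * π * Complex.I * z := by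
      rw [hz]
      push_cast
      field_simp
      rw [Complex.I_sq]
      ring
    push_cast
    rw [hkey, div_add_div _ _ hn1 hn2, hxz]
    field_simp
    ring
  · rw [hz]
    push_cast at he ⊢
    have hI := Complex.I_ne_zero
    field_simp
    ring_nf

lemma integral_sin_div_exp_sub_one {x : ℝ} (hx : 0 < x) :
    ∫ u in Ioi (0 : ℝ), sin (x * u) / (exp (2 * π * u) - 1) =
      (1 + exp (-x)) / (4 * (1 - exp (-x))) - 1 / (2 * x) := by
  have hc (n : ℕ) : 0 < 2 * π * ((n : ℝ) + 1) := by positivity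
  have hbound (n : ℕ) : ∀ᵐ u ∂volume.restrict (Ioi (0 : ℝ)),
      ‖sin (x * u) * exp (-(2 * π * (n + 1) * u))‖ ≤
        x * (u * exp (-(2 * π * (n + 1) * u))) := by
    filter_upwards [ae_restrict_mem measurableSet_Ioi] with u hu
    rw [norm_mul, norm_eq_abs, norm_eq_abs, abs_of_pos (exp_pos _), ← mul_assoc]
    gcongr
    exact abs_sin_le_abs.trans_eq (abs_of_pos (mul_pos hx hu))
  have hint (n : ℕ) := (integrableOn_id_mul_exp_neg_mul_Ioi (hc n)).const_mul x
  have hsum := hasSum_integral_of_summable_integral_norm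
    (μ := volume.restrict (Ioi (0 : ℝ)))
    (F := fun (n : ℕ) (u : ℝ) ↦ sin (x * u) * exp (-(2 * π * (n + 1) * u)))
    (fun n ↦ (hint n).mono' (by fun_prop) (hbound n)) ?_
  · simp_rw [integral_sin_mul_exp_neg_mul_Ioi (hc _)] at hsum
    rw [(hasSum_div_add_sq hx).unique hsum]
    refine setIntegral_congr_fun measurableSet_Ioi fun u hu ↦ ?_
    simpa [div_eq_mul_inv] using ((hasSum_exp_neg_two_pi_mul hu).mul_left (sin (x * u))).tsum_eq.symm
  · refine Summable.of_nonneg_of_le (fun n ↦ integral_nonneg fun _ ↦ norm_nonneg _)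
      (fun n ↦ integral_mono_of_nonneg (.of_forall fun _ ↦ norm_nonneg _) (hint n) (hbound n)) ?_
    simp_rw [integral_const_mul, integral_id_mul_exp_neg_mul_Ioi (hc _)]
    have h := ((summable_nat_add_iff 1).2
      (Real.summable_one_div_nat_pow.2 one_lt_two)).mul_left (x / (2 * π) ^ 2)
    convert! h using 2 with n
    push_cast
    field_simp

lemma integrable_sin_mul_exp_div_exp_sub_one {q : ℝ} (hq : 0 < q) :
    Integrable (fun p : ℝ × ℝ ↦ exp (-(q * p.1)) * (sin (p.1 * p.2) / (exp (2 * π * p.2) - 1)))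
      ((volume.restrict (Ioi 0)).prod (volume.restrict (Ioi 0))) := by
  refine ((integrableOn_id_mul_exp_neg_mul_Ioi hq).mul_prod
    (integrableOn_exp_neg_mul_Ioi pi_pos)).mono' (by fun_prop) ?_
  rw [Measure.prod_restrict]
  filter_upwards [ae_restrict_mem (measurableSet_Ioi.prod measurableSet_Ioi)] with ⟨x, u⟩ ⟨hx, hu⟩
  have hx : 0 < x := hx
  have hu : 0 < u := hu
  have h := mul_exp_pi_mul_le hu.le
  have hpos : 0 < u * exp (π * u) := by positivity
  simp only [norm_mul, norm_div, norm_eq_abs, abs_of_pos (exp_pos _),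
    abs_of_pos (hpos.trans_le h)]
  have h1 : |sin (x * u)| ≤ x * u := abs_sin_le_abs.trans_eq (abs_of_pos (by positivity))
  calc exp (-(q * x)) * (|sin (x * u)| / (exp (2 * π * u) - 1))
      ≤ exp (-(q * x)) * (x * u / (u * exp (π * u))) := by gcongr
    _ = x * exp (-(q * x)) * exp (-(π * u)) := by
      rw [exp_neg (π * u)]
      field_simp

lemma integral_I0_eq_laplace {q : ℝ} (hq : 0 < q) :
    ∫ t in Ioi (0 : ℝ), t / ((1 + t ^ 2) * (exp (2 * π * q * t) - 1)) =
      ∫ x in Ioi (0 : ℝ), exp (-(q * x)) *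
        ((1 + exp (-x)) / (4 * (1 - exp (-x))) - 1 / (2 * x)) := by
  have hswap := integral_integral_swap
    (f := fun x u ↦ exp (-(q * x)) * (sin (x * u) / (exp (2 * π * u) - 1))) (integrable_sin_mul_exp_div_exp_sub_one hq)
  have hleft : ∫ x in Ioi (0 : ℝ), exp (-(q * x)) *
        ((1 + exp (-x)) / (4 * (1 - exp (-x))) - 1 / (2 * x)) =
      ∫ x in Ioi (0 : ℝ), ∫ u in Ioi (0 : ℝ),
        exp (-(q * x)) * (sin (x * u) / (exp (2 * π * u) - 1)) := by
    refine setIntegral_congr_fun measurableSet_Ioi fun x hx ↦ ?_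
    simp only [integral_const_mul, integral_sin_div_exp_sub_one hx]
  rw [hleft, hswap]
  have hright (u : ℝ) : ∫ x in Ioi (0 : ℝ),
      exp (-(q * x)) * (sin (x * u) / (exp (2 * π * u) - 1)) =
        u / (q ^ 2 + u ^ 2) / (exp (2 * π * u) - 1) := by
    rw [← integral_sin_mul_exp_neg_mul_Ioi hq, ← integral_div]
    congr with x
    rw [mul_comm x u]
    ring
  simp_rw [hright]
  have h := integral_comp_mul_left_Ioi' (fun u ↦ u / (q ^ 2 + u ^ 2) / (exp (2 * π * u) - 1)) 0 hq
  rw [mul_zero] at h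
  rw [← h, smul_eq_mul, ← integral_const_mul]
  congr with t
  rw [show q ^ 2 + (q * t) ^ 2 = q ^ 2 * (1 + t ^ 2) by ring, mul_assoc (2 * π)]
  field_simp

lemma integrableOn_laplace_kernel {q : ℝ} (hq : 0 < q) :
    IntegrableOn (fun x ↦ exp (-(q * x)) *
        ((1 + exp (-x)) / (4 * (1 - exp (-x))) - 1 / (2 * x))) (Ioi 0) := by
  refine (integrableOn_congr_fun (fun x hx ↦ ?_) measurableSet_Ioi).1
    (integrable_sin_mul_exp_div_exp_sub_one hq).integral_prod_left
  simp only [integral_const_mul, integral_sin_div_exp_sub_one hx]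

lemma integral_exp_sub_exp_div {q : ℝ} (hq : 0 < q) :
    IntegrableOn (fun x ↦ x⁻¹ * (exp (-(q * x)) - exp (-((q + 1) * x)))) (Ioi 0) ∧
    ∫ x in Ioi (0 : ℝ), x⁻¹ * (exp (-(q * x)) - exp (-((q + 1) * x))) =
      log ((q + 1) / q) := by
  have hint : IntegrableOn (fun x ↦ x⁻¹ * (exp (-(q * x)) - exp (-((q + 1) * x)))) (Ioi 0) := by
    refine (integrableOn_exp_neg_mul_Ioi hq).mono' (by fun_prop) ?_
    filter_upwards [ae_restrict_mem measurableSet_Ioi] with x hx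
    have hx : 0 < x := hx
    have e : exp (-((q + 1) * x)) = exp (-(q * x)) * exp (-x) := by rw [← exp_add]; ring_nf
    have h1 : exp (-x) ≤ 1 := by simpa using hx.le
    have h2 : 1 - exp (-x) ≤ x := by linarith [add_one_le_exp (-x)]
    have e2 : x⁻¹ * (exp (-(q * x)) - exp (-((q + 1) * x))) =
        exp (-(q * x)) * ((1 - exp (-x)) / x) := by rw [e]; field_simp
    rw [e2, norm_eq_abs, abs_of_nonneg (mul_nonneg (exp_pos _).le
      (div_nonneg (sub_nonneg.2 h1) hx.le))]
    exact mul_le_of_le_one_right (exp_pos _).le ((div_le_one hx).2 h2)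
  refine ⟨hint, ?_⟩
  have hcont : Continuous fun x : ℝ ↦ exp (-x) := by fun_prop
  have h := Frullani.integral_Ioi_eq (f := fun x : ℝ ↦ exp (-x)) (a := q) (b := q + 1)
    (L := 1) (R := 0) (hcont.locallyIntegrable.locallyIntegrableOn _) hq
    (by positivity) ?_ tendsto_exp_neg_atTop_nhds_zero (by simpa using hint)
  · simpa using h
  · simpa using (hcont.tendsto 0).mono_left nhdsWithin_le_nhds

lemma integral_I0_sub_add_one {q : ℝ} (hq : 0 < q) :
    (∫ t in Ioi (0 : ℝ), t / ((1 + t ^ 2) * (exp (2 * π * q * t) - 1))) -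
      ∫ t in Ioi (0 : ℝ), t / ((1 + t ^ 2) * (exp (2 * π * (q + 1) * t) - 1)) =
      1 / 4 * (1 / q + 1 / (q + 1)) - 1 / 2 * log ((q + 1) / q) := by
  have hq1 : 0 < q + 1 := by positivity
  rw [integral_I0_eq_laplace hq, integral_I0_eq_laplace hq1,
    ← integral_sub (integrableOn_laplace_kernel hq) (integrableOn_laplace_kernel hq1)]
  obtain ⟨hF, hFe⟩ := integral_exp_sub_exp_div hq
  have hE := integrableOn_exp_neg_mul_Ioi hq
  have hE1 := integrableOn_exp_neg_mul_Ioi hq1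
  rw [← hFe, ← integral_exp_neg_mul_Ioi hq, ← integral_exp_neg_mul_Ioi hq1,
    ← integral_add hE hE1, ← integral_const_mul, ← integral_const_mul,
    ← integral_sub (.const_mul (f := fun x ↦ exp (-(q * x)) + exp (-((q + 1) * x)))
      (hE.add hE1) _) (hF.const_mul _)]
  refine setIntegral_congr_fun measurableSet_Ioi fun x hx ↦ ?_
  have hx : 0 < x := hx
  have e : exp (-((q + 1) * x)) = exp (-(q * x)) * exp (-x) := by rw [← exp_add]; ring_nf
  have h1 : 1 - exp (-x) ≠ 0 := (sub_pos.2 (by simpa using hx : exp (-x) < 1)).ne'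
  simp only [e]
  field_simp

lemma integral_I0_nonneg {q : ℝ} (hq : 0 < q) :
    0 ≤ ∫ t in Ioi (0 : ℝ), t / ((1 + t ^ 2) * (exp (2 * π * q * t) - 1)) := by
  refine setIntegral_nonneg measurableSet_Ioi fun t ht ↦ ?_
  have ht : 0 < t := ht
  have : 1 ≤ exp (2 * π * q * t) := one_le_exp (by positivity)
  exact div_nonneg ht.le (mul_nonneg (by positivity) (sub_nonneg.2 this))

lemma integral_I0_le {q : ℝ} (hq : 0 < q) :
    ∫ t in Ioi (0 : ℝ), t / ((1 + t ^ 2) * (exp (2 * π * q * t) - 1)) ≤ 1 / (4 * q) := by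
  have h : ∫ t in Ioi (0 : ℝ), 1 / (2 * π * q) * (1 + t ^ 2)⁻¹ = 1 / (4 * q) := by
    rw [integral_const_mul, integral_Ioi_inv_one_add_sq, arctan_zero]
    field_simp
    ring
  rw [← h]
  refine integral_mono_of_nonneg ?_ (integrable_inv_one_add_sq.integrableOn.const_mul _) ?_
  · filter_upwards [ae_restrict_mem measurableSet_Ioi] with t ht
    have ht : 0 < t := ht
    have : 1 ≤ exp (2 * π * q * t) := one_le_exp (by positivity)
    exact div_nonneg ht.le (mul_nonneg (by positivity) (sub_nonneg.2 this))
  · filter_upwards [ae_restrict_mem measurableSet_Ioi] with t ht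
    have ht : 0 < t := ht
    have h2 : 2 * π * q * t ≤ exp (2 * π * q * t) - 1 := by
      linarith [add_one_le_exp (2 * π * q * t)]
    calc t / ((1 + t ^ 2) * (exp (2 * π * q * t) - 1))
        ≤ t / ((1 + t ^ 2) * (2 * π * q * t)) := by gcongr
      _ = 1 / (2 * π * q) * (1 + t ^ 2)⁻¹ := by field_simp

lemma deriv_Gamma_add_one_div {q : ℝ} (hq : 0 < q) :
    deriv Gamma (q + 1) / Gamma (q + 1) = deriv Gamma q / Gamma q + 1 / q := by
  have hd : DifferentiableAt ℝ Gamma q :=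
    differentiableAt_Gamma fun m ↦ ne_of_gt (by linarith [m.cast_nonneg (α := ℝ)])
  have h : deriv Gamma (q + 1) = Gamma q + q * deriv Gamma q := by
    rw [← deriv_comp_add_const]
    have : (fun x ↦ Gamma (x + 1)) =ᶠ[𝓝 q] fun x ↦ x * Gamma x := by
      filter_upwards [eventually_gt_nhds hq] with x hx using Gamma_add_one hx.ne'
    rw [this.deriv_eq]
    simpa using (HasDerivAt.fun_mul (hasDerivAt_id' q) hd.hasDerivAt).deriv
  have := (Gamma_pos_of_pos hq).ne'
  rw [h, Gamma_add_one hq.ne']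
  field_simp
  ring

lemma deriv_Gamma_div_le_log {q : ℝ} (hq : 0 < q) :
    deriv Gamma q / Gamma q ≤ log q ∧ log q ≤ deriv Gamma (q + 1) / Gamma (q + 1) := by
  have hder {x : ℝ} (hx : 0 < x) : HasDerivAt (log ∘ Gamma) (deriv Gamma x / Gamma x) x :=
    (differentiableAt_Gamma fun m ↦ ne_of_gt
      (by linarith [m.cast_nonneg (α := ℝ)])).hasDerivAt.log (Gamma_pos_of_pos hx).ne'
  have hq1 : 0 < q + 1 := by positivity
  have hs : slope (log ∘ Gamma) q (q + 1) = log q := by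
    rw [slope_def_field, Function.comp_apply, Function.comp_apply, Gamma_add_one hq.ne',
      log_mul hq.ne' (Gamma_pos_of_pos hq).ne']
    ring
  constructor
  · exact (convexOn_log_Gamma.le_slope_of_hasDerivAt hq hq1 (by linarith) (hder hq)).trans_eq hs
  · exact hs.symm.trans_le
      (convexOn_log_Gamma.slope_le_of_hasDerivAt hq hq1 (by linarith) (hder hq1))

theorem integral_I0 (q : ℝ) (hq : 0 < q) :
    ∫ t in Set.Ioi (0 : ℝ), t / ((1 + t ^ 2) * (Real.exp (2 * π * q * t) - 1)) =
      (1 / 2) * Real.log q - 1 / (4 * q) -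
        (1 / 2) * (deriv Real.Gamma q / Real.Gamma q) := by
  set D : ℝ → ℝ := fun q ↦
    (∫ t in Set.Ioi (0 : ℝ), t / ((1 + t ^ 2) * (Real.exp (2 * π * q * t) - 1))) -
      ((1 / 2) * Real.log q - 1 / (4 * q) - (1 / 2) * (deriv Real.Gamma q / Real.Gamma q)) with hD
  have hstep {x : ℝ} (hx : 0 < x) : D (x + 1) = D x := by
    have h := integral_I0_sub_add_one hx
    rw [log_div (by positivity) hx.ne'] at h
    have h4 (y : ℝ) : 1 / (4 * y) = 1 / 4 * (1 / y) := by rw [one_div_mul_one_div]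
    simp only [hD, deriv_Gamma_add_one_div hx, h4]
    linarith
  have hbound {x : ℝ} (hx : 0 < x) : |D x| ≤ 1 / 2 * (1 / x) := by
    have h1 := integral_I0_nonneg hx
    have h2 := integral_I0_le hx
    obtain ⟨h3, h5⟩ := deriv_Gamma_div_le_log hx
    rw [deriv_Gamma_add_one_div hx] at h5
    have h4 : 1 / (4 * x) = 1 / 4 * (1 / x) := by rw [one_div_mul_one_div]
    rw [h4] at h2
    simp only [hD, h4]
    rw [abs_le]
    constructor <;> linarith
  have hconst (n : ℕ) : D (q + n) = D q := by
    induction n with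
    | zero => simp
    | succ n ih => rw [Nat.cast_succ, ← add_assoc, hstep (by positivity), ih]
  have hlim : Tendsto (fun n : ℕ ↦ 1 / 2 * (1 / (q + n))) atTop (𝓝 0) := by
    simpa using (tendsto_inv_atTop_zero.comp
      (tendsto_atTop_add_const_left _ q tendsto_natCast_atTop_atTop)).const_mul (1 / 2 : ℝ)
  have hle : |D q| ≤ 0 := ge_of_tendsto' hlim fun n ↦ by
    rw [← hconst n]
    exact hbound (by positivity)
  exact sub_eq_zero.1 (abs_nonpos_iff.1 hle)
end

section
/- ∫_0^∞ arctan(t)/(e^{2πt} − 1) dt = 1/2 − (1/2) ln √(2π). -/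
open Real MeasureTheory Set Filter Topology

lemma summable_inv_sq_two_pi_mul_succ :
    Summable fun k : ℕ => 1 / (2 * π * (k + 1)) ^ 2 := by
  have h : Summable fun k : ℕ => 1 / ((k + 1 : ℕ) : ℝ) ^ 2 :=
    (summable_nat_add_iff 1).2 (Real.summable_one_div_nat_pow.2 one_lt_two)
  refine (h.mul_left (1 / (2 * π) ^ 2)).congr fun k => ?_
  push_cast
  field_simp

/-- The partial fraction expansion of the hyperbolic cotangent. -/
lemma hasSum_coth_partial_fractions {s : ℝ} (hs : 0 < s) :
    HasSum (fun k : ℕ => 1 / (s ^ 2 + (2 * π * (k + 1)) ^ 2))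
      (((1 + exp (-s)) / (1 - exp (-s)) - 2 / s) / (4 * s)) := by
  have hsum : Summable fun k : ℕ => 1 / (s ^ 2 + (2 * π * (k + 1)) ^ 2) := by
    refine summable_inv_sq_two_pi_mul_succ.of_nonneg_of_le (fun k => by positivity) fun k => ?_
    gcongr
    nlinarith [sq_nonneg s]
  rw [hsum.hasSum_iff, eq_comm]
  have hsC : (s : ℂ) ≠ 0 := by exact_mod_cast hs.ne'
  have hpC : (π : ℂ) ≠ 0 := by exact_mod_cast pi_ne_zero
  obtain ⟨z, hz_def⟩ : ∃ z : ℂ, z = Complex.I * s / (2 * π) := ⟨_, rfl⟩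
  have hz_im : z.im = s / (2 * π) := by
    have : z = ((s / (2 * π) : ℝ) : ℂ) * Complex.I := by
      rw [hz_def]; push_cast; ring
    rw [this, Complex.im_ofReal_mul, Complex.I_im, mul_one]
  have hz : z ∈ Complex.integerComplement := by
    rintro ⟨n, hn⟩
    have := congrArg Complex.im hn
    rw [hz_im, Complex.intCast_im] at this
    exact (div_pos hs two_pi_pos).ne this
  have hterm (k : ℕ) : 1 / (z - (k + 1)) + 1 / (z + (k + 1)) =
      -4 * π * Complex.I * s * ((1 / (s ^ 2 + (2 * π * (k + 1)) ^ 2) : ℝ) : ℂ) := by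
    have hpos : (s : ℂ) ^ 2 + (2 * π * (k + 1)) ^ 2 ≠ 0 := by
      exact_mod_cast (by positivity : s ^ 2 + (2 * π * (k + 1)) ^ 2 ≠ 0)
    have h1 : z - (k + 1) ≠ 0 := by
      intro h
      have := congrArg Complex.im h
      simp [hz_im, hs.ne'] at this
    have h2 : z + (k + 1) ≠ 0 := by
      intro h
      have := congrArg Complex.im h
      simp [hz_im, hs.ne'] at this
    have hzs : (2 * π * z) = Complex.I * s := by rw [hz_def]; field_simp
    push_cast
    rw [div_add_div _ _ h1 h2, mul_one_div, div_eq_div_iff (mul_ne_zero h1 h2) hpos]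
    have hzs2 : (2 * π * z) ^ 2 = - (s : ℂ) ^ 2 := by rw [hzs, mul_pow, Complex.I_sq]; ring
    linear_combination (2 * z) * hzs2 - 4 * π * (z ^ 2 - (k + 1) ^ 2) * hzs
  have hcot := cot_series_rep' hz
  rw [tsum_congr hterm, tsum_mul_left, ← Complex.ofReal_tsum, Complex.cot_eq_exp_ratio] at hcot
  have harg : 2 * Complex.I * (π * z) = ((-s : ℝ) : ℂ) := by
    rw [hz_def]; push_cast; field_simp; rw [Complex.I_sq]
  have hexp : (1 : ℂ) - Complex.exp ((-s : ℝ) : ℂ) ≠ 0 := by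
    rw [← Complex.ofReal_exp]
    exact_mod_cast (sub_pos.2 (exp_lt_one_iff.2 (neg_lt_zero.2 hs))).ne'
  rw [harg] at hcot
  apply Complex.ofReal_injective
  push_cast at hcot hexp ⊢
  have hI := Complex.I_sq
  rw [hz_def] at hcot
  have hk : (-4 * π * Complex.I * s : ℂ) ≠ 0 := by
    simp [hsC]
  apply mul_left_cancel₀ hk
  rw [← hcot]
  field_simp
  rw [Complex.I_sq]
  ring

lemma integral_arctan_mul_exp {c : ℝ} (hc : 0 < c) :
    ∫ t in Ioi (0 : ℝ), arctan t * exp (-c * t) =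
      ∫ s in Ioi (0 : ℝ), exp (-(1 * s)) / (s ^ 2 + c ^ 2) := by
  have hexp := exp_neg_integrableOn_Ioi 0 hc
  have h1 : IntegrableOn (fun t => arctan t * exp (-c * t)) (Ioi 0) := by
    refine hexp.bdd_mul (c := π / 2) (by fun_prop) (.of_forall fun t => ?_)
    rw [Real.norm_eq_abs, abs_le]
    exact ⟨(neg_pi_div_two_lt_arctan t).le, (arctan_lt_pi_div_two t).le⟩
  have h2 : IntegrableOn (fun t => 1 / (c * (1 + t ^ 2)) * exp (-c * t)) (Ioi 0) := by
    refine hexp.bdd_mul (c := 1 / c) (Measurable.aestronglyMeasurable (by fun_prop))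
      (.of_forall fun t => ?_)
    rw [Real.norm_eq_abs, abs_of_nonneg (by positivity)]
    gcongr
    nlinarith [mul_nonneg hc.le (sq_nonneg t)]
  have hderiv (t : ℝ) : HasDerivAt (fun t => -(arctan t * exp (-c * t)) / c)
      (arctan t * exp (-c * t) - 1 / (c * (1 + t ^ 2)) * exp (-c * t)) t := by
    have hlin : HasDerivAt (fun t : ℝ => -c * t) (-c) t := by
      simpa using (hasDerivAt_id t).const_mul (-c)
    refine (((hasDerivAt_arctan t).mul hlin.exp).neg.div_const c).congr_deriv ?_
    have : 1 + t ^ 2 ≠ 0 := by positivity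
    field_simp
    ring
  have hlim : Tendsto (fun t => -(arctan t * exp (-c * t)) / c) atTop (𝓝 0) := by
    have he : Tendsto (fun t : ℝ => exp (-c * t)) atTop (𝓝 0) :=
      tendsto_exp_atBot.comp (tendsto_id.const_mul_atTop_of_neg (neg_lt_zero.2 hc))
    have ha : Tendsto arctan atTop (𝓝 (π / 2)) :=
      tendsto_arctan_atTop.mono_right nhdsWithin_le_nhds
    simpa using (ha.mul he).neg.div_const c
  have hparts := integral_Ioi_of_hasDerivAt_of_tendsto' (a := 0) (fun t _ => hderiv t)
    (h1.sub h2) hlim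
  rw [integral_sub h1 h2, arctan_zero, zero_mul, neg_zero, zero_div, sub_zero, sub_eq_zero]
    at hparts
  have hsubst := integral_comp_mul_left_Ioi' (fun s => exp (-(1 * s)) / (s ^ 2 + c ^ 2)) 0 hc
  rw [mul_zero] at hsubst
  rw [hparts, ← hsubst, smul_eq_mul, ← integral_const_mul]
  refine integral_congr_ae (.of_forall fun t => ?_)
  have : 1 + t ^ 2 ≠ 0 := by positivity
  have h3 : (c * t) ^ 2 + c ^ 2 ≠ 0 := by positivity
  simp only [one_mul, neg_mul]
  field_simp
  ring

lemma exp_div_sq_add_sq_le {x c : ℝ} (hc : 0 < c) (s : ℝ) :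
    exp (-(x * s)) / (s ^ 2 + c ^ 2) ≤ 1 / c ^ 2 * exp (-x * s) := by
  rw [neg_mul, one_div_mul_eq_div]
  gcongr
  nlinarith [sq_nonneg s]

lemma integrableOn_exp_div_sq_add_sq {x c : ℝ} (hx : 0 < x) (hc : 0 < c) :
    IntegrableOn (fun s => exp (-(x * s)) / (s ^ 2 + c ^ 2)) (Ioi 0) := by
  refine ((exp_neg_integrableOn_Ioi 0 hx).const_mul (1 / c ^ 2)).mono' ?_ (.of_forall fun s => ?_)
  · exact Measurable.aestronglyMeasurable (by fun_prop)
  · rw [Real.norm_eq_abs, abs_of_nonneg (by positivity)]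
    exact exp_div_sq_add_sq_le hc s

/-- The `k`-th term in the expansion of half the remainder in Stirling's formula for `log Γ x`. -/
noncomputable def binetTerm (x : ℝ) (k : ℕ) : ℝ :=
  ∫ s in Ioi (0 : ℝ), exp (-(x * s)) / (s ^ 2 + (2 * π * (k + 1)) ^ 2)

lemma binetTerm_nonneg (x : ℝ) (k : ℕ) : 0 ≤ binetTerm x k :=
  integral_nonneg fun s => by positivity

lemma binetTerm_le {x : ℝ} (hx : 0 < x) (k : ℕ) :
    binetTerm x k ≤ 1 / (2 * π * (k + 1)) ^ 2 * (1 / x) := by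
  have hc : 0 < 2 * π * ((k : ℝ) + 1) := by positivity
  calc binetTerm x k
      ≤ ∫ s in Ioi (0 : ℝ), 1 / (2 * π * (k + 1)) ^ 2 * exp (-x * s) :=
        integral_mono (integrableOn_exp_div_sq_add_sq hx hc)
          ((exp_neg_integrableOn_Ioi 0 hx).const_mul _) fun s => exp_div_sq_add_sq_le hc s
    _ = _ := by
        rw [integral_const_mul, integral_exp_mul_Ioi (neg_lt_zero.2 hx), mul_zero, exp_zero,
          neg_div_neg_eq]

lemma summable_binetTerm {x : ℝ} (hx : 0 < x) : Summable (binetTerm x) :=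
  (summable_inv_sq_two_pi_mul_succ.mul_right (1 / x)).of_nonneg_of_le (binetTerm_nonneg x)
    (binetTerm_le hx)

lemma tendsto_tsum_binetTerm :
    Tendsto (fun n : ℕ => ∑' k, binetTerm (n + 1) k) atTop (𝓝 0) := by
  have h : Tendsto (fun n : ℕ => (∑' k : ℕ, 1 / (2 * π * (k + 1)) ^ 2) * (1 / ((n : ℝ) + 1)))
      atTop (𝓝 0) := by
    simpa only [mul_zero] using (tendsto_one_div_add_atTop_nhds_zero_nat (𝕜 := ℝ)).const_mul
      (∑' k : ℕ, 1 / (2 * π * ((k : ℝ) + 1)) ^ 2)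
  refine squeeze_zero (fun n => tsum_nonneg (binetTerm_nonneg _)) (fun n => ?_) h
  have hn : (0 : ℝ) < n + 1 := by positivity
  rw [← tsum_mul_right]
  exact (summable_binetTerm hn).tsum_le_tsum (binetTerm_le hn)
    (summable_inv_sq_two_pi_mul_succ.mul_right _)

lemma integral_arctan_div_exp_eq_tsum :
    ∫ t in Ioi (0 : ℝ), arctan t / (exp (2 * π * t) - 1) = ∑' k, binetTerm 1 k := by
  have hc (k : ℕ) : 0 < 2 * π * ((k : ℝ) + 1) := by positivity
  have hint (k : ℕ) : IntegrableOn (fun t => arctan t * exp (-(2 * π * (k + 1)) * t)) (Ioi 0) := by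
    refine (exp_neg_integrableOn_Ioi 0 (hc k)).bdd_mul (c := π / 2) (by fun_prop)
      (.of_forall fun t => ?_)
    rw [Real.norm_eq_abs, abs_le]
    exact ⟨(neg_pi_div_two_lt_arctan t).le, (arctan_lt_pi_div_two t).le⟩
  have hnorm (k : ℕ) :
      ∫ t in Ioi (0 : ℝ), ‖arctan t * exp (-(2 * π * (k + 1)) * t)‖ = binetTerm 1 k := by
    rw [binetTerm, ← integral_arctan_mul_exp (hc k)]
    refine setIntegral_congr_fun measurableSet_Ioi fun t ht => ?_
    exact Real.norm_of_nonneg (mul_nonneg (arctan_nonneg.2 (le_of_lt ht)) (exp_pos _).le)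
  have hswap := integral_tsum_of_summable_integral_norm hint
    ((summable_binetTerm one_pos).congr fun k => (hnorm k).symm)
  simp_rw [integral_arctan_mul_exp (hc _)] at hswap
  unfold binetTerm
  rw [hswap]
  refine setIntegral_congr_fun measurableSet_Ioi fun t ht => ?_
  have hlt : exp (-(2 * π * t)) < 1 := exp_lt_one_iff.2 (neg_lt_zero.2 (mul_pos two_pi_pos ht))
  have hterm (k : ℕ) : arctan t * exp (-(2 * π * (k + 1)) * t) =
      arctan t * exp (-(2 * π * t)) * exp (-(2 * π * t)) ^ k := by
    rw [← exp_nat_mul, mul_assoc (arctan t), ← exp_add]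
    ring_nf
  simp_rw [hterm]
  rw [tsum_mul_left, tsum_geometric_of_lt_one (exp_pos _).le hlt]
  have hne : 1 - exp (-(2 * π * t)) ≠ 0 := (sub_pos.2 hlt).ne'
  rw [exp_neg] at hne ⊢
  have hpos := exp_pos (2 * π * t)
  have hne' : exp (2 * π * t) - 1 ≠ 0 := by
    intro h
    apply hne
    rw [sub_eq_zero.1 h]; norm_num
  field_simp

lemma integral_half_sub_mul_exp (x : ℝ) {s : ℝ} (hs : 0 < s) :
    ∫ v in (0 : ℝ)..1, (1 / 2 - v) * exp (-(x + v) * s) =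
      exp (-(x * s)) * ((1 + exp (-s)) / (2 * s) - (1 - exp (-s)) / s ^ 2) := by
  have hderiv (v : ℝ) :
      HasDerivAt (fun v => ((v - 1 / 2) / s + 1 / s ^ 2) * exp (-(x + v) * s))
        ((1 / 2 - v) * exp (-(x + v) * s)) v := by
    have hlin : HasDerivAt (fun v : ℝ => -(x + v) * s) (-1 * s) v :=
      (((hasDerivAt_id v).const_add x).neg).mul_const s
    refine (((((hasDerivAt_id v).sub_const (1 / 2)).div_const s).add_const (1 / s ^ 2)).mul
      hlin.exp).congr_deriv ?_
    simp only [id]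
    field_simp
    ring
  rw [intervalIntegral.integral_eq_sub_of_hasDerivAt (fun v _ => hderiv v)
    (Continuous.intervalIntegrable (by fun_prop) _ _)]
  have h1 : exp (-(x + 1) * s) = exp (-(x * s)) * exp (-s) := by
    rw [← exp_add]; ring_nf
  rw [h1, add_zero, neg_mul]
  field_simp
  ring

lemma integral_half_sub_div {x : ℝ} (hx : 0 < x) :
    ∫ v in (0 : ℝ)..1, (1 / 2 - v) * (1 / (x + v)) =
      (x + 1 / 2) * (log (x + 1) - log x) - 1 := by
  have hpos : ∀ v ∈ uIcc (0 : ℝ) 1, x + v ≠ 0 := fun v hv => by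
    rw [uIcc_of_le zero_le_one] at hv
    linarith [hv.1]
  have hderiv : ∀ v ∈ uIcc (0 : ℝ) 1,
      HasDerivAt (fun v => (x + 1 / 2) * log (x + v) - v) ((1 / 2 - v) * (1 / (x + v))) v := by
    intro v hv
    refine (((((hasDerivAt_id v).const_add x).log (hpos v hv)).const_mul (x + 1 / 2)).sub
      (hasDerivAt_id v)).congr_deriv ?_
    have := hpos v hv
    simp only [id]
    field_simp
    ring
  rw [intervalIntegral.integral_eq_sub_of_hasDerivAt hderiv]
  · rw [add_zero]; ring
  · refine ContinuousOn.intervalIntegrable ?_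
    exact ContinuousOn.mul (by fun_prop) (continuousOn_const.div (by fun_prop) hpos)

lemma integral_integral_half_sub_mul_exp {x : ℝ} (hx : 0 < x) :
    ∫ s in Ioi (0 : ℝ), ∫ v in (0 : ℝ)..1, (1 / 2 - v) * exp (-(x + v) * s) =
      (x + 1 / 2) * (log (x + 1) - log x) - 1 := by
  rw [← intervalIntegral_integral_swap, ← integral_half_sub_div hx]
  · refine intervalIntegral.integral_congr fun v hv => ?_
    rw [uIcc_of_le zero_le_one] at hv
    have hv' : -(x + v) < 0 := by linarith [hv.1]
    rw [integral_const_mul, integral_exp_mul_Ioi hv', mul_zero, exp_zero, neg_div_neg_eq]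
  · rw [uIoc_of_le zero_le_one]
    have hdom : Integrable (fun p : ℝ × ℝ => (1 : ℝ) * exp (-x * p.2))
        ((volume.restrict (Ioc (0 : ℝ) 1)).prod (volume.restrict (Ioi 0))) :=
      (integrable_const 1).mul_prod (exp_neg_integrableOn_Ioi 0 hx)
    refine hdom.mono' (Continuous.aestronglyMeasurable (by fun_prop)) ?_
    rw [Measure.prod_restrict]
    refine (ae_restrict_iff' (measurableSet_Ioc.prod measurableSet_Ioi)).2
      (.of_forall fun ⟨v, s⟩ ⟨hv, hs⟩ => ?_)
    simp only [mem_Ioc, mem_Ioi] at hv hs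
    simp only [Function.uncurry, norm_mul, Real.norm_eq_abs, abs_exp]
    gcongr
    · rw [abs_le]; constructor <;> linarith [hv.1, hv.2]
    · linarith [hv.1]

lemma tsum_binetTerm_sub {x : ℝ} (hx : 0 < x) :
    ∑' k, binetTerm x k - ∑' k, binetTerm (x + 1) k =
      1 / 2 * ((x + 1 / 2) * (log (x + 1) - log x) - 1) := by
  have hx1 : 0 < x + 1 := by linarith
  have hc (k : ℕ) : 0 < 2 * π * ((k : ℝ) + 1) := by positivity
  have hint (k : ℕ) := (integrableOn_exp_div_sq_add_sq hx (hc k)).sub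
    (integrableOn_exp_div_sq_add_sq hx1 (hc k))
  have heq (k : ℕ) : binetTerm x k - binetTerm (x + 1) k =
      ∫ s in Ioi (0 : ℝ), (exp (-(x * s)) / (s ^ 2 + (2 * π * (k + 1)) ^ 2) -
        exp (-((x + 1) * s)) / (s ^ 2 + (2 * π * (k + 1)) ^ 2)) :=
    (integral_sub (integrableOn_exp_div_sq_add_sq hx (hc k))
      (integrableOn_exp_div_sq_add_sq hx1 (hc k))).symm
  have hsum := (summable_binetTerm hx).sub (summable_binetTerm hx1)
  have hswap := integral_tsum_of_summable_integral_norm hint (hsum.congr fun k => by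
    rw [heq]
    refine setIntegral_congr_fun measurableSet_Ioi fun s hs => ?_
    refine (Real.norm_of_nonneg (sub_nonneg.2 ?_)).symm
    have hs : 0 < s := hs
    gcongr
    linarith)
  rw [← (summable_binetTerm hx).tsum_sub (summable_binetTerm hx1),
    ← integral_integral_half_sub_mul_exp hx, ← integral_const_mul, tsum_congr heq]
  refine hswap.trans (setIntegral_congr_fun measurableSet_Ioi fun s hs => ?_)
  have hs : 0 < s := hs
  have hterm (k : ℕ) : exp (-(x * s)) / (s ^ 2 + (2 * π * (k + 1)) ^ 2) -
      exp (-((x + 1) * s)) / (s ^ 2 + (2 * π * (k + 1)) ^ 2) =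
      exp (-(x * s)) * (1 - exp (-s)) * (1 / (s ^ 2 + (2 * π * (k + 1)) ^ 2)) := by
    have h1 : exp (-((x + 1) * s)) = exp (-(x * s)) * exp (-s) := by
      rw [← exp_add]; ring_nf
    rw [h1]; ring
  have hne : 1 - exp (-s) ≠ 0 := (sub_pos.2 (exp_lt_one_iff.2 (neg_lt_zero.2 hs))).ne'
  simp only [Pi.sub_apply]
  rw [tsum_congr hterm, tsum_mul_left, (hasSum_coth_partial_fractions hs).tsum_eq,
    integral_half_sub_mul_exp x hs]
  field_simp
  ring

lemma log_stirlingSeq_sub_log_stirlingSeq_succ_eq (n : ℕ) :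
    log (Stirling.stirlingSeq (n + 1)) - log (Stirling.stirlingSeq (n + 2)) =
      ((n + 1 : ℝ) + 1 / 2) * (log ((n + 1 : ℝ) + 1) - log (n + 1)) - 1 := by
  have h1 : (n : ℝ) + 1 ≠ 0 := by positivity
  have h2 : (n : ℝ) + 1 + 1 ≠ 0 := by positivity
  have hf : ((n + 1 + 1).factorial : ℝ) = ((n : ℝ) + 1 + 1) * ((n + 1).factorial : ℝ) := by
    rw [Nat.factorial_succ]; push_cast; ring
  rw [Stirling.log_stirlingSeq_formula, Stirling.log_stirlingSeq_formula, hf,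
    log_mul h2 (by positivity)]
  push_cast
  rw [show (n : ℝ) + 2 = n + 1 + 1 by ring, log_mul two_ne_zero h1, log_mul two_ne_zero h2,
    log_div h1 (exp_ne_zero _), log_div h2 (exp_ne_zero _), log_exp]
  ring

lemma tsum_binetTerm_one :
    ∑' k, binetTerm 1 k = 1 / 2 * (log (Stirling.stirlingSeq 1) - log √π) := by
  have hconst (n : ℕ) :
      1 / 2 * log (Stirling.stirlingSeq (n + 1)) - ∑' k, binetTerm (n + 1) k =
        1 / 2 * log (Stirling.stirlingSeq 1) - ∑' k, binetTerm 1 k := by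
    induction n with
    | zero => simp
    | succ n ih =>
      rw [← ih]
      have h1 := tsum_binetTerm_sub (x := (n : ℝ) + 1) (by positivity)
      rw [← log_stirlingSeq_sub_log_stirlingSeq_succ_eq] at h1
      push_cast
      linarith
  have hlim : Tendsto (fun n : ℕ =>
      1 / 2 * log (Stirling.stirlingSeq (n + 1)) - ∑' k, binetTerm (n + 1) k)
      atTop (𝓝 (1 / 2 * log √π - 0)) :=
    ((((tendsto_add_atTop_iff_nat 1).2 Stirling.tendsto_stirlingSeq_sqrt_pi).log
      (by positivity)).const_mul _).sub tendsto_tsum_binetTerm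
  simp_rw [hconst] at hlim
  linarith [tendsto_nhds_unique hlim tendsto_const_nhds]

theorem integral_T0_one :
    ∫ t in Set.Ioi (0 : ℝ), Real.arctan t / (Real.exp (2 * π * t) - 1) =
      1 / 2 - (1 / 2) * Real.log (Real.sqrt (2 * π)) := by
  rw [integral_arctan_div_exp_eq_tsum, tsum_binetTerm_one, Stirling.stirlingSeq_one,
    log_div (exp_ne_zero 1) (by positivity), log_exp, sqrt_mul zero_le_two,
    log_mul (by positivity) (by positivity)]
  ring
end

section
/- ∫_0^∞ arctan(t)/(e^{πt/2} − 1) dt = 1/2 − ln π − 2 ln 2 + 2 ln Γ(1/4). -/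
open Real MeasureTheory

open Filter Topology

lemma summable_one_div_add_one_sq : Summable fun k : ℕ => 1 / ((k : ℝ) + 1) ^ 2 := by
  exact_mod_cast (summable_nat_add_iff 1).2 (Real.summable_one_div_nat_pow.2 one_lt_two)

lemma integrableOn_exp_neg_div_one_add_sq {b : ℝ} (hb : 0 < b) :
    IntegrableOn (fun t : ℝ => exp (-b * t) / (1 + t ^ 2)) (Set.Ioi 0) := by
  have h (t : ℝ) : 1 + t ^ 2 ≠ 0 := by positivity
  refine (exp_neg_integrableOn_Ioi 0 hb).mono'
    (Continuous.aestronglyMeasurable (by fun_prop (disch := exact h _))) (ae_of_all _ fun t => ?_)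
  rw [norm_of_nonneg (by positivity)]
  exact div_le_self (exp_pos _).le (by nlinarith [sq_nonneg t])

lemma integrableOn_arctan_mul_exp_neg {b : ℝ} (hb : 0 < b) :
    IntegrableOn (fun t : ℝ => arctan t * exp (-b * t)) (Set.Ioi 0) := by
  refine ((exp_neg_integrableOn_Ioi 0 hb).const_mul (π / 2)).mono'
    (Continuous.aestronglyMeasurable (by fun_prop)) (ae_of_all _ fun t => ?_)
  rw [norm_mul, norm_of_nonneg (exp_pos _).le, norm_eq_abs]
  gcongr
  exact abs_le.2 ⟨(neg_pi_div_two_lt_arctan t).le, (arctan_lt_pi_div_two t).le⟩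

lemma integral_exp_neg_div_one_add_sq_nonneg (b : ℝ) :
    0 ≤ ∫ t in Set.Ioi (0 : ℝ), exp (-b * t) / (1 + t ^ 2) :=
  integral_nonneg fun t => by positivity

lemma integral_exp_neg_div_one_add_sq_le {b : ℝ} (hb : 0 < b) :
    ∫ t in Set.Ioi (0 : ℝ), exp (-b * t) / (1 + t ^ 2) ≤ 1 / b := by
  have h : ∫ t in Set.Ioi (0 : ℝ), exp (-b * t) = 1 / b := by
    rw [integral_exp_mul_Ioi (by linarith)]
    simp
  rw [← h]
  refine integral_mono (integrableOn_exp_neg_div_one_add_sq hb)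
    (exp_neg_integrableOn_Ioi 0 hb) fun t => ?_
  exact div_le_self (exp_pos _).le (by nlinarith [sq_nonneg t])

lemma integral_arctan_mul_exp_neg {b : ℝ} (hb : 0 < b) :
    ∫ t in Set.Ioi (0 : ℝ), arctan t * exp (-b * t) =
      1 / b * ∫ t in Set.Ioi (0 : ℝ), exp (-b * t) / (1 + t ^ 2) := by
  have hI := integrableOn_exp_neg_div_one_add_sq hb
  have hA := integrableOn_arctan_mul_exp_neg hb
  have hexp : Tendsto (fun t : ℝ => exp (-b * t)) atTop (𝓝 0) :=
    tendsto_exp_atBot.comp (tendsto_id.const_mul_atTop_of_neg (neg_neg_iff_pos.2 hb))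
  have key := integral_Ioi_of_hasDerivAt_of_tendsto' (a := 0) (m := 0)
    (f := fun t => -(1 / b) * (arctan t * exp (-b * t)))
    (f' := fun t => arctan t * exp (-b * t) - 1 / b * (exp (-b * t) / (1 + t ^ 2)))
    (fun t _ => by
      have h1 := ((hasDerivAt_id t).const_mul (-b)).exp
      refine (((hasDerivAt_arctan t).mul h1).const_mul (-(1 / b))).congr_deriv ?_
      simp only [id]
      have : 1 + t ^ 2 ≠ 0 := by positivity
      field_simp
      ring)
    (hA.sub (hI.const_mul _))
    (by simpa using ((tendsto_nhds_of_tendsto_nhdsWithin tendsto_arctan_atTop).mul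
      hexp).const_mul (-(1 / b)))
  rw [integral_sub hA (hI.const_mul _), integral_const_mul] at key
  simp only [arctan_zero, zero_mul, mul_zero, sub_zero] at key
  linarith

lemma hasSum_integral_arctan_div_exp_sub_one {c : ℝ} (hc : 0 < c) :
    HasSum (fun k : ℕ => 1 / (c * (k + 1)) *
        ∫ t in Set.Ioi (0 : ℝ), exp (-(c * (k + 1)) * t) / (1 + t ^ 2))
      (∫ t in Set.Ioi (0 : ℝ), arctan t / (exp (c * t) - 1)) := by
  have hpos (k : ℕ) : 0 < c * (k + 1) := by positivity
  have key := hasSum_integral_of_summable_integral_norm (μ := volume.restrict (Set.Ioi (0 : ℝ)))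
    (F := fun (k : ℕ) t => arctan t * exp (-(c * (k + 1)) * t))
    (fun k => integrableOn_arctan_mul_exp_neg (hpos k)) ?_
  · convert! key using 1
    · ext k
      exact (integral_arctan_mul_exp_neg (hpos k)).symm
    · refine setIntegral_congr_fun measurableSet_Ioi fun t (ht : 0 < t) => ?_
      have hlt : exp (-(c * t)) < 1 := exp_lt_one_iff.2 (by nlinarith [mul_pos hc ht])
      have hg := (hasSum_geometric_of_lt_one (exp_pos _).le hlt).mul_left
        (arctan t * exp (-(c * t)))
      have hterm (k : ℕ) : arctan t * exp (-(c * (k + 1)) * t) =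
          arctan t * exp (-(c * t)) * exp (-(c * t)) ^ k := by
        rw [← exp_nat_mul, mul_assoc, ← exp_add]
        congr 2
        ring
      simp only [hterm, hg.tsum_eq]
      have h1 : exp (c * t) - 1 ≠ 0 := (sub_pos.2 (one_lt_exp_iff.2 (mul_pos hc ht))).ne'
      rw [exp_neg]
      have := exp_ne_zero (c * t)
      field_simp
  · have hs : Summable fun k : ℕ => 1 / c ^ 2 * (1 / ((k : ℝ) + 1) ^ 2) :=
      summable_one_div_add_one_sq.mul_left _
    refine hs.of_nonneg_of_le (fun k => integral_nonneg fun _ => norm_nonneg _) fun k => ?_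
    have hn : ∫ t in Set.Ioi (0 : ℝ), ‖arctan t * exp (-(c * (k + 1)) * t)‖ =
        ∫ t in Set.Ioi (0 : ℝ), arctan t * exp (-(c * (k + 1)) * t) :=
      setIntegral_congr_fun measurableSet_Ioi fun t (ht : 0 < t) =>
        norm_of_nonneg (mul_nonneg (arctan_nonneg.2 ht.le) (exp_pos _).le)
    rw [hn, integral_arctan_mul_exp_neg (hpos k)]
    calc _ ≤ 1 / (c * (k + 1)) * (1 / (c * (k + 1))) := by
          gcongr
          exact integral_exp_neg_div_one_add_sq_le (hpos k)
      _ = _ := by field_simp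

lemma integral_one_sub_cos_mul_exp_neg {a : ℝ} (ha : a ≠ 0) (hcos : cos a = 1) (hsin : sin a = 0)
    {c : ℝ} (hc : 0 < c) :
    ∫ x in (0 : ℝ)..1, (1 - cos (a * x)) * exp (-c * x) =
      (1 - exp (-c)) * (a ^ 2 / (c * (a ^ 2 + c ^ 2))) := by
  have hac : a ^ 2 + c ^ 2 ≠ 0 := by positivity
  have hd (x : ℝ) : HasDerivAt (fun x => -(exp (-c * x) / c) -
      exp (-c * x) * (a * sin (a * x) - c * cos (a * x)) / (a ^ 2 + c ^ 2))
      ((1 - cos (a * x)) * exp (-c * x)) x := by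
    have h1 := ((hasDerivAt_id x).const_mul (-c)).exp
    have h2 := ((hasDerivAt_id x).const_mul a).sin
    have h3 := ((hasDerivAt_id x).const_mul a).cos
    refine ((h1.div_const c).neg.sub ((h1.mul ((h2.const_mul a).sub
      (h3.const_mul c))).div_const (a ^ 2 + c ^ 2))).congr_deriv ?_
    simp only [id, Pi.sub_apply]
    field_simp
    ring
  rw [intervalIntegral.integral_eq_sub_of_hasDerivAt (fun x _ => hd x)
    (Continuous.intervalIntegrable (by fun_prop) _ _)]
  simp only [mul_one, mul_zero, hcos, hsin, cos_zero, sin_zero, exp_zero]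
  field_simp
  ring

lemma integral_mul_exp_neg {b : ℝ} (hb : 0 < b) :
    IntegrableOn (fun t : ℝ => t * exp (-b * t)) (Set.Ioi 0) ∧
      ∫ t in Set.Ioi (0 : ℝ), t * exp (-b * t) = 1 / b ^ 2 := by
  have h := integral_rpow_mul_exp_neg_mul_Ioi (a := 2) (r := b) (by norm_num) hb
  have h2 : ∫ t in Set.Ioi (0 : ℝ), t * exp (-b * t) = 1 / b ^ 2 := by
    norm_num at h
    simpa [neg_mul] using h
  exact ⟨.of_integral_ne_zero (by rw [h2]; positivity), h2⟩

lemma integral_one_sub_cos_div_add_sq {a : ℝ} (ha : 0 < a) (hcos : cos a = 1) (hsin : sin a = 0)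
    {z : ℝ} (hz : 0 < z) :
    ∫ x in (0 : ℝ)..1, (1 - cos (a * x)) / (x + z) ^ 2 =
      a * ((∫ t in Set.Ioi (0 : ℝ), exp (-(a * z) * t) / (1 + t ^ 2)) -
        ∫ t in Set.Ioi (0 : ℝ), exp (-(a * (z + 1)) * t) / (1 + t ^ 2)) := by
  have hint : Integrable (Function.uncurry fun x t : ℝ =>
      (1 - cos (a * x)) * (t * exp (-(a * (x + z)) * t)))
      ((volume.restrict (Set.uIoc 0 1)).prod (volume.restrict (Set.Ioi 0))) := by
    have hdom : Integrable (fun p : ℝ × ℝ => (2 : ℝ) * (p.2 * exp (-(a * z) * p.2)))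
        ((volume.restrict (Set.uIoc 0 1)).prod (volume.restrict (Set.Ioi 0))) :=
      Integrable.mul_prod (f := fun _ : ℝ => (2 : ℝ)) continuous_const.integrableOn_uIoc
        (integral_mul_exp_neg (mul_pos ha hz)).1
    refine hdom.mono' (Continuous.aestronglyMeasurable (by unfold Function.uncurry; fun_prop)) ?_
    rw [Measure.prod_restrict, ae_restrict_iff' (measurableSet_uIoc.prod measurableSet_Ioi)]
    refine ae_of_all _ ?_
    rintro ⟨x, t⟩ ⟨hx, ht⟩
    simp only [Set.uIoc_of_le zero_le_one, Set.mem_Ioc, Set.mem_Ioi] at hx ht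
    have hc : |1 - cos (a * x)| ≤ 2 :=
      abs_le.2 ⟨by linarith [cos_le_one (a * x)], by linarith [neg_one_le_cos (a * x)]⟩
    simp only [Function.uncurry, norm_mul, norm_eq_abs, abs_exp, abs_of_pos ht]
    gcongr
    linarith
  have hleft (x : ℝ) (hx : 0 ≤ x) : (1 - cos (a * x)) / (x + z) ^ 2 =
      a ^ 2 * ∫ t in Set.Ioi (0 : ℝ), (1 - cos (a * x)) * (t * exp (-(a * (x + z)) * t)) := by
    rw [integral_const_mul, (integral_mul_exp_neg (b := a * (x + z)) (by positivity)).2]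
    field_simp
  rw [intervalIntegral.integral_congr (g := fun x => a ^ 2 * ∫ t in Set.Ioi (0 : ℝ),
    (1 - cos (a * x)) * (t * exp (-(a * (x + z)) * t))) fun x hx => hleft x
      (by rw [Set.uIcc_of_le zero_le_one] at hx; exact hx.1),
    intervalIntegral.integral_const_mul, intervalIntegral_integral_swap hint,
    ← integral_sub (integrableOn_exp_neg_div_one_add_sq (by positivity))
      (integrableOn_exp_neg_div_one_add_sq (by positivity)),
    ← integral_const_mul, ← integral_const_mul]
  refine setIntegral_congr_fun measurableSet_Ioi fun t (ht : 0 < t) => ?_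
  have hx (x : ℝ) : (1 - cos (a * x)) * (t * exp (-(a * (x + z)) * t)) =
      t * exp (-(a * z) * t) * ((1 - cos (a * x)) * exp (-(a * t) * x)) := by
    rw [show -(a * (x + z)) * t = -(a * z) * t + -(a * t) * x by ring, exp_add]
    ring
  simp only [hx]
  rw [intervalIntegral.integral_const_mul,
    integral_one_sub_cos_mul_exp_neg ha.ne' hcos hsin (mul_pos ha ht),
    show -(a * (z + 1)) * t = -(a * z) * t + -(a * t) by ring, exp_add]
  have h1 : 1 + t ^ 2 ≠ 0 := by positivity
  have h2 : a ^ 2 + (a * t) ^ 2 = a ^ 2 * (1 + t ^ 2) := by ring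
  rw [h2]
  field_simp

lemma hasSum_one_sub_cos_div_sq {x : ℝ} (hx : x ∈ Set.Icc (0 : ℝ) 1) :
    HasSum (fun k : ℕ => 1 / (2 * π ^ 2 * (k + 1) ^ 2) * (1 - cos (2 * π * (k + 1) * x)))
      ((x - x ^ 2) / 2) := by
  have h1 := hasSum_one_div_nat_pow_mul_cos one_ne_zero hx
  have h2 := (hasSum_zeta_two.sub h1).mul_left (1 / (2 * π ^ 2))
  have h3 := (hasSum_nat_add_iff' 1).2 h2
  have hB : (Polynomial.map (algebraMap ℚ ℝ) (Polynomial.bernoulli (2 * 1))).eval x =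
      x ^ 2 - x + 1 / 6 := by
    rw [Polynomial.bernoulli]
    simp [Finset.sum_range_succ, Polynomial.eval_monomial, bernoulli_two, bernoulli_one,
      bernoulli_zero, Nat.choose]
    ring
  rw [hB] at h3
  convert! h3 using 1
  · ext k
    push_cast
    field_simp
  · norm_num
    field_simp
    ring

lemma hasSum_integral_one_sub_cos {z : ℝ} (hz : 0 < z) :
    HasSum (fun k : ℕ => 1 / (2 * π ^ 2 * (k + 1) ^ 2) *
        ∫ x in (0 : ℝ)..1, (1 - cos (2 * π * (k + 1) * x)) / (x + z) ^ 2)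
      (∫ x in (0 : ℝ)..1, (x - x ^ 2) / 2 / (x + z) ^ 2) := by
  have hs : Summable fun k : ℕ => 1 / (π ^ 2 * z ^ 2) * (1 / ((k : ℝ) + 1) ^ 2) :=
    summable_one_div_add_one_sq.mul_left _
  simp only [← intervalIntegral.integral_const_mul]
  refine intervalIntegral.hasSum_integral_of_dominated_convergence
    (fun k _ => 1 / (π ^ 2 * z ^ 2) * (1 / ((k : ℝ) + 1) ^ 2)) (fun k => ?_) (fun k => ?_)
    (ae_of_all _ fun _ _ => hs) (by simp) (ae_of_all _ fun x hx => ?_)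
  · exact Measurable.aestronglyMeasurable (by fun_prop)
  · refine ae_of_all _ fun x hx => ?_
    rw [Set.uIoc_of_le zero_le_one] at hx
    have hx0 := hx.1
    have hc : |1 - cos (2 * π * (k + 1) * x)| ≤ 2 :=
      abs_le.2 ⟨by linarith [cos_le_one (2 * π * (k + 1) * x)],
        by linarith [neg_one_le_cos (2 * π * (k + 1) * x)]⟩
    rw [norm_mul, norm_of_nonneg (by positivity : 0 ≤ 1 / (2 * π ^ 2 * ((k : ℝ) + 1) ^ 2)),
      norm_div, norm_of_nonneg (by positivity : 0 ≤ (x + z) ^ 2), norm_eq_abs]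
    calc _ ≤ 1 / (2 * π ^ 2 * ((k : ℝ) + 1) ^ 2) * (2 / z ^ 2) := by
          gcongr
          linarith
      _ = _ := by field_simp
  · rw [Set.uIoc_of_le zero_le_one] at hx
    convert! (hasSum_one_sub_cos_div_sq ⟨hx.1.le, hx.2⟩).div_const ((x + z) ^ 2) using 2
    ring

lemma integral_sub_sq_div_add_sq {z : ℝ} (hz : 0 < z) :
    ∫ x in (0 : ℝ)..1, (x - x ^ 2) / 2 / (x + z) ^ 2 =
      (z + 1 / 2) * (log (z + 1) - log z) - 1 := by
  have hne {x : ℝ} (hx : x ∈ Set.uIcc (0 : ℝ) 1) : x + z ≠ 0 := by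
    rw [Set.uIcc_of_le zero_le_one] at hx
    linarith [hx.1]
  have hd (x : ℝ) (hx : x ∈ Set.uIcc (0 : ℝ) 1) : HasDerivAt
      (fun x => (z + 1 / 2) * log (x + z) - x / 2 + (z + z ^ 2) / 2 * (x + z)⁻¹)
      ((x - x ^ 2) / 2 / (x + z) ^ 2) x := by
    have h0 := (hasDerivAt_id x).add_const z
    refine ((((h0.log (hne hx)).const_mul (z + 1 / 2)).sub ((hasDerivAt_id x).div_const 2)).add
      ((h0.inv (hne hx)).const_mul ((z + z ^ 2) / 2))).congr_deriv ?_
    have := hne hx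
    simp only [id]
    field_simp
    ring
  rw [intervalIntegral.integral_eq_sub_of_hasDerivAt hd
    (ContinuousOn.intervalIntegrable
      (by fun_prop (disch := intro x hx; exact pow_ne_zero 2 (hne hx))))]
  rw [zero_add, add_comm 1 z]
  field_simp
  ring

/-- The series for the integral `2 * ∫ arctan (t / z) / (exp (2 * π * t) - 1)` over `(0, ∞)`,
obtained by expanding the integrand in powers of `exp (-2 * π * t)`. -/
noncomputable def binetSeries (z : ℝ) : ℝ :=
  ∑' k : ℕ, 1 / (π * (k + 1)) *
    ∫ t in Set.Ioi (0 : ℝ), exp (-(2 * π * (k + 1) * z) * t) / (1 + t ^ 2)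

lemma binetSeries_term_le {z : ℝ} (hz : 0 < z) (k : ℕ) :
    1 / (π * (k + 1)) * ∫ t in Set.Ioi (0 : ℝ), exp (-(2 * π * (k + 1) * z) * t) / (1 + t ^ 2) ≤
      1 / (2 * π ^ 2) * (1 / ((k : ℝ) + 1) ^ 2) * z⁻¹ := by
  calc _ ≤ 1 / (π * (k + 1)) * (1 / (2 * π * (k + 1) * z)) := by
        gcongr
        exact integral_exp_neg_div_one_add_sq_le (by positivity)
    _ = _ := by field_simp

lemma binetSeries_term_nonneg (z : ℝ) (k : ℕ) :
    0 ≤ 1 / (π * (k + 1)) *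
      ∫ t in Set.Ioi (0 : ℝ), exp (-(2 * π * (k + 1) * z) * t) / (1 + t ^ 2) :=
  mul_nonneg (by positivity) (integral_exp_neg_div_one_add_sq_nonneg _)

lemma summable_binetSeries_bound :
    Summable fun k : ℕ => 1 / (2 * π ^ 2) * (1 / ((k : ℝ) + 1) ^ 2) :=
  summable_one_div_add_one_sq.mul_left _

lemma summable_binetSeries {z : ℝ} (hz : 0 < z) :
    Summable fun k : ℕ => 1 / (π * (k + 1)) *
      ∫ t in Set.Ioi (0 : ℝ), exp (-(2 * π * (k + 1) * z) * t) / (1 + t ^ 2) :=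
  (summable_binetSeries_bound.mul_right z⁻¹).of_nonneg_of_le (binetSeries_term_nonneg z)
    (binetSeries_term_le hz)

lemma tendsto_binetSeries : Tendsto binetSeries atTop (𝓝 0) := by
  have h (C : ℝ) : Tendsto (fun z : ℝ => C * z⁻¹) atTop (𝓝 0) := by
    simpa using tendsto_inv_atTop_zero.const_mul C
  refine tendsto_of_tendsto_of_tendsto_of_le_of_le' tendsto_const_nhds
    (h (∑' k : ℕ, 1 / (2 * π ^ 2) * (1 / ((k : ℝ) + 1) ^ 2)))
    (Eventually.of_forall fun z => tsum_nonneg (binetSeries_term_nonneg z)) ?_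
  filter_upwards [eventually_gt_atTop 0] with z hz
  rw [← tsum_mul_right]
  exact (summable_binetSeries hz).tsum_le_tsum (binetSeries_term_le hz)
    (summable_binetSeries_bound.mul_right z⁻¹)

lemma binetSeries_sub_binetSeries_add_one {z : ℝ} (hz : 0 < z) :
    binetSeries z - binetSeries (z + 1) = (z + 1 / 2) * (log (z + 1) - log z) - 1 := by
  rw [binetSeries, binetSeries,
    ← (summable_binetSeries hz).tsum_sub (summable_binetSeries (by positivity)),
    ← integral_sub_sq_div_add_sq hz, ← (hasSum_integral_one_sub_cos hz).tsum_eq]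
  refine tsum_congr fun k => ?_
  have hcos : cos (2 * π * (k + 1)) = 1 := by
    have := cos_nat_mul_two_pi (k + 1)
    push_cast at this
    rwa [mul_comm] at this
  have hsin : sin (2 * π * (k + 1)) = 0 := by
    have := sin_nat_mul_pi (2 * (k + 1))
    push_cast at this
    rwa [mul_right_comm, mul_right_comm 2, ← mul_right_comm] at this
  rw [integral_one_sub_cos_div_add_sq (by positivity) hcos hsin hz]
  field_simp

/-- The remainder in Stirling's formula for `log Γ`. -/
noncomputable def stirlingRemainder (z : ℝ) : ℝ :=
  log (Gamma z) - ((z - 1 / 2) * log z - z + 1 / 2 * log (2 * π))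

lemma stirlingRemainder_sub_stirlingRemainder_add_one {z : ℝ} (hz : 0 < z) :
    stirlingRemainder z - stirlingRemainder (z + 1) =
      (z + 1 / 2) * (log (z + 1) - log z) - 1 := by
  rw [stirlingRemainder, stirlingRemainder, Gamma_add_one hz.ne',
    log_mul hz.ne' (Gamma_pos_of_pos hz).ne']
  ring

lemma log_Gamma_add_nat {x : ℝ} (hx : 0 < x) (n : ℕ) :
    log (Gamma (x + n)) = log (Gamma x) + ∑ m ∈ Finset.range n, log (x + m) := by
  induction n with
  | zero => simp
  | succ n ih =>
    have h : 0 < x + n := by positivity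
    rw [Finset.sum_range_succ, ← add_assoc, ← ih, Nat.cast_succ, ← add_assoc,
      Gamma_add_one h.ne', log_mul h.ne' (Gamma_pos_of_pos h).ne', add_comm]

lemma tendsto_stirlingRemainder_add_nat {x : ℝ} (hx : 0 < x) :
    Tendsto (fun n : ℕ => stirlingRemainder (x + n)) atTop (𝓝 0) := by
  rw [← tendsto_add_atTop_iff_nat 1]
  have hG : Tendsto (fun n => log (Gamma x) - BohrMollerup.logGammaSeq x n) atTop (𝓝 0) := by
    simpa using (BohrMollerup.tendsto_log_gamma hx).const_sub (log (Gamma x))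
  have hS : Tendsto (fun n => log (Stirling.stirlingSeq n) - 1 / 2 * log π) atTop (𝓝 0) := by
    have := (Stirling.tendsto_stirlingSeq_sqrt_pi.log (by positivity)).sub_const (1 / 2 * log π)
    rwa [log_sqrt pi_pos.le, show log π / 2 - 1 / 2 * log π = 0 by ring] at this
  have hL : Tendsto (fun n : ℕ => (n : ℝ) * log (1 + (x + 1) / n)) atTop (𝓝 (x + 1)) :=
    (tendsto_mul_log_one_add_div_atTop (x + 1)).comp tendsto_natCast_atTop_atTop
  have hL0 : Tendsto (fun n : ℕ => log (1 + (x + 1) / n)) atTop (𝓝 0) := by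
    have h : Tendsto (fun n : ℕ => 1 + (x + 1) / n) atTop (𝓝 1) := by
      simpa using (tendsto_const_div_atTop_nhds_zero_nat (x + 1)).const_add 1
    simpa using h.log one_ne_zero
  have hlim := (hG.add hS).add ((hL.add (hL0.const_mul (x + 1 / 2))).const_sub (x + 1))
  rw [show (0 : ℝ) + 0 + (x + 1 - (x + 1 + (x + 1 / 2) * 0)) = 0 by ring] at hlim
  refine hlim.congr' ?_
  filter_upwards [eventually_gt_atTop 0] with n hn
  have hn' : (0 : ℝ) < n := by exact_mod_cast hn
  have hlog : log (1 + (x + 1) / n) = log (x + (n + 1 : ℕ)) - log n := by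
    rw [← log_div (by positivity) hn'.ne']
    congr 1
    push_cast
    field_simp
    ring
  rw [hlog, stirlingRemainder, log_Gamma_add_nat hx, BohrMollerup.logGammaSeq,
    Stirling.log_stirlingSeq_formula, log_div hn'.ne' (exp_pos 1).ne', log_exp,
    log_mul two_ne_zero hn'.ne', log_mul two_ne_zero pi_ne_zero]
  push_cast
  ring

/-- **Binet's second formula**, in series form. -/
lemma binetSeries_eq_stirlingRemainder {z : ℝ} (hz : 0 < z) :
    binetSeries z = stirlingRemainder z := by
  have hper (n : ℕ) : binetSeries (z + n) - stirlingRemainder (z + n) =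
      binetSeries z - stirlingRemainder z := by
    induction n with
    | zero => simp
    | succ n ih =>
      have h : 0 < z + n := by positivity
      have h1 := binetSeries_sub_binetSeries_add_one h
      have h2 := stirlingRemainder_sub_stirlingRemainder_add_one h
      rw [Nat.cast_succ, ← add_assoc]
      linarith
  have hlim : Tendsto (fun n : ℕ => binetSeries (z + n) - stirlingRemainder (z + n))
      atTop (𝓝 (0 - 0)) :=
    (tendsto_binetSeries.comp (tendsto_const_nhds.add_atTop tendsto_natCast_atTop_atTop)).sub
      (tendsto_stirlingRemainder_add_nat hz)
  simp only [hper, sub_zero] at hlim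
  exact sub_eq_zero.1 (tendsto_nhds_unique tendsto_const_nhds hlim)

theorem integral_T0_quarter :
    ∫ t in Set.Ioi (0 : ℝ), Real.arctan t / (Real.exp (π * t / 2) - 1) =
      1 / 2 - Real.log π - 2 * Real.log 2 + 2 * Real.log (Real.Gamma (1 / 4)) := by
  have hI : ∫ t in Set.Ioi (0 : ℝ), arctan t / (exp (π * t / 2) - 1) =
      2 * binetSeries (1 / 4) := by
    simp only [show ∀ t : ℝ, π * t / 2 = π / 2 * t from fun t => by ring]
    rw [← (hasSum_integral_arctan_div_exp_sub_one pi_div_two_pos).tsum_eq, binetSeries,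
      ← tsum_mul_left]
    refine tsum_congr fun k => ?_
    rw [show 2 * π * ((k : ℝ) + 1) * (1 / 4) = π / 2 * (k + 1) by ring]
    field_simp
  have hlog : log (1 / 4) = -(2 * log 2) := by
    rw [one_div, log_inv, show (4 : ℝ) = 2 ^ 2 by norm_num, log_pow]
    norm_num
  rw [hI, binetSeries_eq_stirlingRemainder (by norm_num), stirlingRemainder, hlog,
    log_mul two_ne_zero pi_ne_zero]
  ring
end

section
/- For every real q > 0, ∫_0^∞ t·ln(1+t²)/(e^{2πqt} − 1) dt = (1/q²)·∂_z ζ(z, q)|_{z=−1} − (ln Γ(q))/q + (ln √(2π))/q − (1/(12q²) − 1/2) ln q − 3/4, where ζ(z, q) is the Hurwitz zeta function and ∂_z ζ(z,q)|_{z=−1} its z-derivative at z = −1. -/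
open Real MeasureTheory Complex

/-- The remainder `1 / (1 - e⁻ˣ) - (1 / x + 1 / 2 + x / 12)`, of order `x ^ 3` at zero. -/
noncomputable def bernoulliRemainder (x : ℝ) : ℝ :=
  1 / (1 - Real.exp (-x)) - 1 / x - 1 / 2 - x / 12

lemma integrableOn_pow_mul_exp_neg (n : ℕ) {c : ℝ} (hc : 0 < c) :
    IntegrableOn (fun t : ℝ => t ^ n * Real.exp (-(c * t))) (Set.Ioi 0) := by
  have h := integrableOn_rpow_mul_exp_neg_mul_rpow (p := 1) (s := n) (b := c)
    (by have : (0 : ℝ) ≤ n := n.cast_nonneg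
        linarith) one_pos hc
  simpa [Real.rpow_natCast] using h

lemma integral_mul_exp_neg_s16 {c : ℝ} (hc : 0 < c) :
    ∫ t in Set.Ioi (0 : ℝ), t * Real.exp (-(c * t)) = 1 / c ^ 2 := by
  have h := Real.integral_rpow_mul_exp_neg_mul_Ioi (a := 2) (r := c) two_pos hc
  norm_num at h
  simpa using h

lemma integrableOn_sin_mul_exp_neg (x : ℝ) {c : ℝ} (hc : 0 < c) :
    IntegrableOn (fun t : ℝ => Real.sin (t * x) * Real.exp (-(c * t))) (Set.Ioi 0) := by
  refine Integrable.mono' (integrableOn_pow_mul_exp_neg 0 hc) (by fun_prop)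
    (.of_forall fun t => ?_)
  rw [norm_mul, Real.norm_eq_abs, Real.norm_eq_abs, Real.abs_exp]
  gcongr
  simpa using Real.abs_sin_le_one (t * x)

lemma integral_sin_mul_exp_neg (x : ℝ) {c : ℝ} (hc : 0 < c) :
    ∫ t in Set.Ioi (0 : ℝ), Real.sin (t * x) * Real.exp (-(c * t)) = x / (x ^ 2 + c ^ 2) := by
  have ha : (-c + x * I : ℂ).re < 0 := by simpa using hc
  have hi := integrableOn_exp_mul_complex_Ioi ha 0
  have h := integral_im hi
  rw [integral_exp_mul_complex_Ioi ha 0] at h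
  convert! h using 1
  · refine setIntegral_congr_fun measurableSet_Ioi fun t _ => ?_
    simp [Complex.exp_im, mul_comm]
  · rw [← neg_div_neg_eq]
    simp [Complex.normSq_apply, Complex.div_im]
    rw [← neg_div_neg_eq]
    ring

lemma hasSum_inv_sq_add_sq {x : ℝ} (hx : 0 < x) :
    HasSum (fun n : ℕ => x / (x ^ 2 + (2 * π * (n + 1)) ^ 2))
      ((1 / (1 - Real.exp (-x)) - 1 / x - 1 / 2) / 2) := by
  have hsum : Summable fun n : ℕ => x / (x ^ 2 + (2 * π * (n + 1)) ^ 2) := by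
    have h2 : Summable fun n : ℕ => x / (2 * π) ^ 2 * (1 / ((n + 1 : ℕ) : ℝ) ^ 2) :=
      (((summable_nat_add_iff 1).2 hasSum_zeta_two.summable)).mul_left _
    refine Summable.of_nonneg_of_le (fun n => by positivity) (fun n => ?_) h2
    rw [div_mul_div_comm, mul_one]
    push_cast
    rw [← mul_pow]
    gcongr
    nlinarith [sq_nonneg x]
  rw [hsum.hasSum_iff]
  set z : ℂ := I * x / (2 * π) with hz
  have hpi : (π : ℂ) ≠ 0 := by exact_mod_cast Real.pi_ne_zero
  have hx0 : (x : ℂ) ≠ 0 := by exact_mod_cast hx.ne'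
  have hzmem : z ∈ integerComplement := by
    rintro ⟨n, hn⟩
    have := congrArg Complex.im hn
    have h2 : z = ((x / (2 * π) : ℝ) : ℂ) * I := by rw [hz]; push_cast; ring
    rw [h2, Complex.mul_I_im, Complex.ofReal_re, Complex.intCast_im] at this
    exact (div_pos hx Real.two_pi_pos).ne this
  have h := cot_series_rep hzmem
  have hterm : ∀ n : ℕ, (1 / (z - ((n + 1 : ℕ) : ℂ)) + 1 / (z + ((n + 1 : ℕ) : ℂ))) =
      (-I * 4 * π) * ((x / (x ^ 2 + (2 * π * (n + 1)) ^ 2) : ℝ) : ℂ) := by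
    intro n
    have hne1 : z - ((n + 1 : ℕ) : ℂ) ≠ 0 := fun h0 =>
      hzmem ⟨(n + 1 : ℕ), by push_cast; push_cast at h0; linear_combination -h0⟩
    have hne2 : z + ((n + 1 : ℕ) : ℂ) ≠ 0 := fun h0 =>
      hzmem ⟨-(n + 1 : ℕ), by push_cast; push_cast at h0; linear_combination -h0⟩
    have hne3 : ((x : ℂ) ^ 2 + (2 * π * (n + 1)) ^ 2) ≠ 0 := by
      have : x ^ 2 + (2 * π * (n + 1)) ^ 2 ≠ 0 := by positivity
      exact_mod_cast this
    have hxz : (x : ℂ) = -2 * π * I * z := by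
      rw [hz]; field_simp; rw [I_sq]; ring
    push_cast at hne1 hne2 ⊢
    rw [div_add_div _ _ hne1 hne2, mul_div_assoc', div_eq_div_iff (mul_ne_zero hne1 hne2) hne3, hxz]
    linear_combination 8 * π ^ 2 * z * (n + 1) ^ 2 * I_sq
  rw [tsum_pnat_eq_tsum_succ (f := fun n : ℕ => 1 / (z - (n : ℂ)) + 1 / (z + (n : ℂ)))] at h
  simp_rw [hterm] at h
  rw [tsum_mul_left, ← Complex.ofReal_tsum, Complex.cot_eq_exp_ratio] at h
  have he : cexp (2 * I * (π * z)) = ((Real.exp (-x) : ℝ) : ℂ) := by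
    rw [hz]; push_cast
    congr 1
    field_simp
    rw [I_sq]
  rw [he] at h
  have hexp : Real.exp (-x) < 1 := by simpa using hx
  have hne : (1 : ℂ) - (Real.exp (-x) : ℝ) ≠ 0 := by
    have : 1 - Real.exp (-x) ≠ 0 := by linarith
    exact_mod_cast this
  apply Complex.ofReal_injective
  push_cast at h hne ⊢
  rw [hz] at h
  set T : ℂ := ∑' n : ℕ, (x : ℂ) / (x ^ 2 + (2 * π * (n + 1)) ^ 2)
  field_simp at h ⊢
  rw [I_sq] at h
  linear_combination -h

lemma hasSum_inv_two_pi_mul_sq :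
    HasSum (fun n : ℕ => 1 / (2 * π * (n + 1)) ^ 2) (1 / 24) := by
  have h := ((hasSum_nat_add_iff' 1).2 hasSum_zeta_two).mul_left (1 / (2 * π) ^ 2)
  convert! h using 1
  · funext n
    push_cast
    field_simp
  · simp
    field_simp
    norm_num

lemma hasSum_exp_neg_nat_succ {c t : ℝ} (ht : 0 < c * t) :
    HasSum (fun n : ℕ => Real.exp (-(c * (n + 1) * t))) (1 / (Real.exp (c * t) - 1)) := by
  have h1 : Real.exp (-(c * t)) < 1 := by simpa using ht
  have h := (hasSum_geometric_of_lt_one (Real.exp_pos _).le h1).mul_left (Real.exp (-(c * t)))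
  convert! h using 1
  · funext n
    rw [← Real.exp_nat_mul, ← Real.exp_add]
    ring_nf
  · have h2 : 1 < Real.exp (c * t) := by simpa using ht
    have h3 : Real.exp (c * t) - 1 ≠ 0 := by linarith
    rw [Real.exp_neg]
    field_simp

lemma bernoulliRemainder_eq_integral {x : ℝ} (hx : 0 < x) :
    bernoulliRemainder x =
      ∫ t in Set.Ioi (0 : ℝ), -(2 * (t * x - Real.sin (t * x)) / (Real.exp (2 * π * t) - 1)) := by
  set F : ℕ → ℝ → ℝ := fun n t =>
    2 * (t * x - Real.sin (t * x)) * Real.exp (-(2 * π * (n + 1) * t)) with hF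
  have hc : ∀ n : ℕ, 0 < 2 * π * ((n : ℝ) + 1) := fun n => by positivity
  have h1 : ∀ n : ℕ, IntegrableOn
      (fun t : ℝ => t * Real.exp (-(2 * π * (n + 1) * t))) (Set.Ioi 0) := fun n => by
    simpa using integrableOn_pow_mul_exp_neg 1 (hc n)
  have h2 := fun n => integrableOn_sin_mul_exp_neg x (hc n)
  have hFeq : ∀ n, F n = fun t => 2 * x * (t * Real.exp (-(2 * π * (n + 1) * t))) -
      2 * (Real.sin (t * x) * Real.exp (-(2 * π * (n + 1) * t))) := fun n => by
    funext t; simp only [hF]; ring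
  have hint : ∀ n, Integrable (F n) (volume.restrict (Set.Ioi 0)) := fun n => by
    rw [hFeq]; exact ((h1 n).const_mul _).sub ((h2 n).const_mul _)
  have hval : ∀ n, ∫ t in Set.Ioi (0 : ℝ), F n t =
      2 * x * (1 / (2 * π * (n + 1)) ^ 2) - 2 * (x / (x ^ 2 + (2 * π * (n + 1)) ^ 2)) := fun n => by
    rw [hFeq, integral_sub ((h1 n).const_mul _) ((h2 n).const_mul _), integral_const_mul,
      integral_const_mul, integral_mul_exp_neg_s16 (hc n), integral_sin_mul_exp_neg x (hc n)]
  have hnorm : ∀ n, ∫ t in Set.Ioi (0 : ℝ), ‖F n t‖ = ∫ t in Set.Ioi (0 : ℝ), F n t := fun n => by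
    refine setIntegral_congr_fun measurableSet_Ioi fun t ht => Real.norm_of_nonneg ?_
    have := Real.sin_le (mul_pos ht hx).le
    have : 0 ≤ t * x - Real.sin (t * x) := by linarith
    positivity
  have hs := (hasSum_inv_two_pi_mul_sq.mul_left (2 * x)).sub ((hasSum_inv_sq_add_sq hx).mul_left 2)
  have hs' : HasSum (fun n => ∫ t in Set.Ioi (0 : ℝ), F n t) (-bernoulliRemainder x) := by
    simp_rw [hval]
    convert! hs using 1
    rw [bernoulliRemainder]; ring
  have h := hasSum_integral_of_summable_integral_norm hint (by simp_rw [hnorm]; exact hs'.summable)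
  rw [integral_neg, eq_neg_iff_add_eq_zero, ← neg_eq_iff_add_eq_zero, hs'.unique h]
  refine setIntegral_congr_fun measurableSet_Ioi fun t ht => ?_
  have := hasSum_exp_neg_nat_succ (mul_pos Real.two_pi_pos ht)
  simp only [hF]
  rw [tsum_mul_left, this.tsum_eq, mul_one_div]

lemma one_div_exp_sub_one_le {y : ℝ} (hy : 0 < y) :
    1 / (Real.exp y - 1) ≤ 1 / y * Real.exp (-(y / 2)) := by
  have h1 : y / 2 ≤ Real.sinh (y / 2) := Real.self_le_sinh_iff.2 (by positivity)
  rw [Real.sinh_eq] at h1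
  have h2 : Real.exp y = Real.exp (y / 2) * Real.exp (y / 2) := by
    rw [← Real.exp_add]; ring_nf
  have h3 : Real.exp (y / 2) * Real.exp (-(y / 2)) = 1 := by rw [← Real.exp_add]; simp
  have h4 : y * Real.exp (y / 2) ≤ Real.exp y - 1 := by
    nlinarith [Real.exp_pos (y / 2)]
  rw [Real.exp_neg, ← one_div, one_div_mul_one_div]
  exact one_div_le_one_div_of_le (by positivity) h4

lemma integrableOn_pow_div_exp_sub_one (n : ℕ) :
    IntegrableOn (fun t : ℝ => t ^ (n + 1) / (Real.exp (2 * π * t) - 1)) (Set.Ioi 0) := by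
  refine Integrable.mono' ((integrableOn_pow_mul_exp_neg n Real.pi_pos).const_mul (1 / (2 * π)))
    (Measurable.aestronglyMeasurable (by fun_prop))
    ((ae_restrict_iff' measurableSet_Ioi).2 (.of_forall fun t ht => ?_))
  have ht : 0 < t := ht
  have h1 : 1 < Real.exp (2 * π * t) := by simp; positivity
  have h := one_div_exp_sub_one_le (y := 2 * π * t) (by positivity)
  rw [Real.norm_of_nonneg (div_nonneg (by positivity) (by linarith)), div_eq_mul_one_div]
  refine (mul_le_mul_of_nonneg_left h (by positivity)).trans (le_of_eq ?_)
  rw [show -(2 * π * t / 2) = -(π * t) by ring]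
  field_simp
  ring

lemma sub_sin_nonneg {y : ℝ} (hy : 0 < y) : 0 ≤ y - Real.sin y := by
  linarith [Real.sin_le hy.le]

lemma sub_sin_le {y : ℝ} (hy : 0 < y) : y - Real.sin y ≤ y ^ 3 / 6 := by
  linarith [Real.sin_gt_sub_cube hy]

lemma exists_abs_bernoulliRemainder_le :
    ∃ C, 0 ≤ C ∧ ∀ x, 0 < x → |bernoulliRemainder x| ≤ C * x ^ 3 := by
  have hpos : ∀ t ∈ Set.Ioi (0 : ℝ), 0 < Real.exp (2 * π * t) - 1 := fun t ht => by
    have : 0 < 2 * π * t := mul_pos Real.two_pi_pos ht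
    linarith [Real.one_lt_exp_iff.2 this]
  refine ⟨∫ t in Set.Ioi (0 : ℝ), t ^ 3 / (Real.exp (2 * π * t) - 1),
    setIntegral_nonneg measurableSet_Ioi fun t ht =>
      div_nonneg (pow_nonneg (le_of_lt ht) _) (hpos t ht).le, fun x hx => ?_⟩
  rw [bernoulliRemainder_eq_integral hx, ← integral_mul_const, ← Real.norm_eq_abs]
  refine norm_integral_le_of_norm_le ((integrableOn_pow_div_exp_sub_one 2).mul_const _)
    ((ae_restrict_iff' measurableSet_Ioi).2 (.of_forall fun t ht => ?_))
  have htx : 0 < t * x := mul_pos ht hx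
  rw [norm_neg, Real.norm_of_nonneg
    (div_nonneg (mul_nonneg two_pos.le (sub_sin_nonneg htx)) (hpos t ht).le), div_mul_eq_mul_div]
  refine div_le_div_of_nonneg_right ?_ (hpos t ht).le
  have : 0 ≤ (t * x) ^ 3 := by positivity
  rw [← mul_pow]
  linarith [sub_sin_le htx]

lemma continuousOn_bernoulliRemainder : ContinuousOn bernoulliRemainder (Set.Ioi 0) := by
  unfold bernoulliRemainder
  have h : ∀ x ∈ Set.Ioi (0 : ℝ), 1 - Real.exp (-x) ≠ 0 := fun x hx => by
    have : Real.exp (-x) < 1 := by simpa using hx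
    linarith
  have h' : ∀ x ∈ Set.Ioi (0 : ℝ), x ≠ 0 := fun x hx => ne_of_gt hx
  fun_prop (disch := assumption)

lemma setIntegral_id_div_sq_add_sq {q : ℝ} (hq : 0 < q) {t : ℝ} (ht : 0 ≤ t) :
    ∫ u in Set.Ioc 0 t, u / (u ^ 2 + q ^ 2) = 1 / 2 * Real.log (1 + t ^ 2 / q ^ 2) := by
  rw [← intervalIntegral.integral_of_le ht]
  have hne : ∀ u : ℝ, u ^ 2 + q ^ 2 ≠ 0 := fun u => by positivity
  have hd : ∀ u ∈ Set.uIcc 0 t,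
      HasDerivAt (fun u => 1 / 2 * Real.log (u ^ 2 + q ^ 2)) (u / (u ^ 2 + q ^ 2)) u := fun u _ => by
    convert! (((hasDerivAt_pow 2 u).add_const (q ^ 2)).log (hne u)).const_mul (1 / 2 : ℝ) using 1
    simp; ring
  rw [intervalIntegral.integral_eq_sub_of_hasDerivAt hd
    (Continuous.intervalIntegrable (by fun_prop (disch := assumption)) _ _), ← mul_sub,
    ← Real.log_div (hne _) (hne _)]
  congr 2
  field_simp
  ring

lemma integral_one_sub_cos_mul_exp_neg_div {q : ℝ} (hq : 0 < q) {t : ℝ} (ht : 0 ≤ t) :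
    ∫ x in Set.Ioi (0 : ℝ), (1 - Real.cos (t * x)) * Real.exp (-(q * x)) / x =
      1 / 2 * Real.log (1 + t ^ 2 / q ^ 2) := by
  have hint : Integrable (Function.uncurry fun x u : ℝ => Real.sin (x * u) * Real.exp (-(q * x)))
      ((volume.restrict (Set.Ioi 0)).prod (volume.restrict (Set.Ioc 0 t))) := by
    have h := (integrableOn_pow_mul_exp_neg 0 hq).mul_prod
      (integrableOn_const (μ := volume) (s := Set.Ioc 0 t) (C := (1 : ℝ)) (by simp))
    refine h.mono' (Continuous.aestronglyMeasurable (by fun_prop)) (.of_forall fun z => ?_)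
    simp only [Function.uncurry, norm_mul, Real.norm_eq_abs, Real.abs_exp, pow_zero, one_mul,
      mul_one]
    exact mul_le_of_le_one_left (Real.exp_pos _).le (Real.abs_sin_le_one _)
  rw [← setIntegral_id_div_sq_add_sq hq ht, ← setIntegral_congr_fun measurableSet_Ioc
    (fun u _ => integral_sin_mul_exp_neg u hq), ← integral_integral_swap hint]
  refine setIntegral_congr_fun measurableSet_Ioi fun x hx => ?_
  have hx0 : x ≠ 0 := ne_of_gt hx
  rw [integral_mul_const, ← intervalIntegral.integral_of_le ht,
    intervalIntegral.integral_comp_mul_left (fun y => Real.sin y) hx0, integral_sin]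
  simp [mul_comm x t]
  field_simp

lemma integral_sub_sin_mul_exp_neg {q : ℝ} (hq : 0 < q) {t : ℝ} (ht : 0 < t) :
    ∫ x in Set.Ioi (0 : ℝ),
      (t * x - Real.sin (t * x)) * Real.exp (-(q * x)) * (q / x + 1 / x ^ 2) =
      t / 2 * Real.log (1 + t ^ 2 / q ^ 2) := by
  have hi1 : IntegrableOn (fun x : ℝ => (1 - Real.cos (t * x)) * Real.exp (-(q * x)) / x)
      (Set.Ioi 0) := by
    refine Integrable.mono' ((integrableOn_pow_mul_exp_neg 1 hq).const_mul (t ^ 2 / 2))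
      (Measurable.aestronglyMeasurable (by fun_prop))
      ((ae_restrict_iff' measurableSet_Ioi).2 (.of_forall fun x hx => ?_))
    have hx : 0 < x := hx
    have hc := Real.cos_le_one (t * x)
    have hc2 := Real.one_sub_sq_div_two_le_cos (x := t * x)
    rw [Real.norm_of_nonneg (by have : 0 ≤ 1 - Real.cos (t * x) := by linarith
                                positivity), div_le_iff₀ hx]
    have := mul_le_mul_of_nonneg_right (by linarith : 1 - Real.cos (t * x) ≤ (t * x) ^ 2 / 2)
      (Real.exp_pos (-(q * x))).le
    linarith
  have hi2 : IntegrableOn (fun x : ℝ =>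
      (t * x - Real.sin (t * x)) * Real.exp (-(q * x)) * (q / x + 1 / x ^ 2)) (Set.Ioi 0) := by
    refine Integrable.mono' (((integrableOn_pow_mul_exp_neg 2 hq).const_mul (t ^ 3 / 6 * q)).add
      ((integrableOn_pow_mul_exp_neg 1 hq).const_mul (t ^ 3 / 6)))
      (Measurable.aestronglyMeasurable (by fun_prop))
      ((ae_restrict_iff' measurableSet_Ioi).2 (.of_forall fun x hx => ?_))
    have hx : 0 < x := hx
    have h0 := sub_sin_nonneg (mul_pos ht hx)
    rw [Real.norm_of_nonneg (by positivity)]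
    calc (t * x - Real.sin (t * x)) * Real.exp (-(q * x)) * (q / x + 1 / x ^ 2)
        ≤ (t * x) ^ 3 / 6 * Real.exp (-(q * x)) * (q / x + 1 / x ^ 2) := by
          gcongr; exact sub_sin_le (mul_pos ht hx)
      _ = _ := by simp only [Pi.add_apply]; field_simp
  set G : ℝ → ℝ := fun x => -((t * x - Real.sin (t * x)) * Real.exp (-(q * x)) / x) with hG
  have hd : ∀ x ∈ Set.Ioi (0 : ℝ), HasDerivAt G
      ((t * x - Real.sin (t * x)) * Real.exp (-(q * x)) * (q / x + 1 / x ^ 2) -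
        t * ((1 - Real.cos (t * x)) * Real.exp (-(q * x)) / x)) x := fun x hx => by
    have hx0 : x ≠ 0 := ne_of_gt hx
    have hl : HasDerivAt (fun x => t * x) t x := by simpa using (hasDerivAt_id x).const_mul t
    have he : HasDerivAt (fun x => -(q * x)) (-q) x := by
      simpa using (hasDerivAt_id x).const_mul (-q)
    convert! (((hl.sub hl.sin).mul he.exp).div (hasDerivAt_id x) hx0).neg using 1
    simp
    field_simp
    ring
  have hbound : ∀ x, 0 ≤ x → |G x| ≤ 2 * t * Real.exp (-(q * x)) := fun x hx => by
    rcases hx.eq_or_lt with rfl | hx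
    · simp [hG, ht.le]
    have h0 := sub_sin_nonneg (mul_pos ht hx)
    rw [hG, abs_neg, abs_of_nonneg (by positivity), div_le_iff₀ hx]
    have h1 : t * x - Real.sin (t * x) ≤ 2 * t * x := by
      linarith [neg_le_of_abs_le ((Real.abs_sin_lt_abs (mul_pos ht hx).ne').le.trans_eq
        (abs_of_pos (mul_pos ht hx)))]
    calc _ ≤ 2 * t * x * Real.exp (-(q * x)) := by gcongr
      _ = _ := by ring
  have hlim : Filter.Tendsto G Filter.atTop (nhds 0) := by
    refine squeeze_zero_norm' ((Filter.eventually_ge_atTop 0).mono hbound) ?_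
    have : Filter.Tendsto (fun x : ℝ => Real.exp (-(q * x))) Filter.atTop (nhds 0) :=
      Real.tendsto_exp_neg_atTop_nhds_zero.comp (Filter.tendsto_id.const_mul_atTop hq)
    simpa using this.const_mul (2 * t)
  have hcont : ContinuousWithinAt G (Set.Ici 0) 0 := by
    have hG0 : G 0 = 0 := by simp [hG]
    rw [ContinuousWithinAt, hG0]
    refine squeeze_zero_norm' (a := fun x => t ^ 3 * x ^ 2 / 6) ?_ ?_
    · filter_upwards [self_mem_nhdsWithin] with x hx
      rcases (show (0 : ℝ) ≤ x from hx).eq_or_lt with rfl | hx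
      · simp [hG]
      have h0 := sub_sin_nonneg (mul_pos ht hx)
      have he : Real.exp (-(q * x)) ≤ 1 := by
        simp; positivity
      rw [hG, norm_neg, Real.norm_of_nonneg (by positivity), div_le_iff₀ hx]
      calc _ ≤ (t * x) ^ 3 / 6 * 1 := by
            gcongr; exact sub_sin_le (mul_pos ht hx)
        _ = _ := by ring
    · have : Continuous fun x : ℝ => t ^ 3 * x ^ 2 / 6 := by fun_prop
      simpa using this.tendsto 0 |>.mono_left nhdsWithin_le_nhds
  have h := integral_Ioi_of_hasDerivAt_of_tendsto hcont hd (hi2.sub (hi1.const_mul t)) hlim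
  rw [integral_sub hi2 (hi1.const_mul t), integral_const_mul,
    integral_one_sub_cos_mul_exp_neg_div hq ht.le] at h
  have hG0 : G 0 = 0 := by simp [hG]
  rw [hG0] at h
  linarith

lemma integral_mul_log_div_exp_sub_one {q : ℝ} (hq : 0 < q) :
    ∫ t in Set.Ioi (0 : ℝ), t * Real.log (1 + t ^ 2 / q ^ 2) / (Real.exp (2 * π * t) - 1) =
      -∫ x in Set.Ioi (0 : ℝ),
        bernoulliRemainder x * (Real.exp (-(q * x)) * (q / x + 1 / x ^ 2)) := by
  have hpos : ∀ t : ℝ, 0 < t → 0 < Real.exp (2 * π * t) - 1 := fun t ht => by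
    have : 0 < 2 * π * t := mul_pos Real.two_pi_pos ht
    linarith [Real.one_lt_exp_iff.2 this]
  set f : ℝ → ℝ → ℝ := fun x t => 2 * (t * x - Real.sin (t * x)) / (Real.exp (2 * π * t) - 1) *
    (Real.exp (-(q * x)) * (q / x + 1 / x ^ 2)) with hf
  have hint : Integrable (Function.uncurry f)
      ((volume.restrict (Set.Ioi 0)).prod (volume.restrict (Set.Ioi 0))) := by
    have h := (((integrableOn_pow_mul_exp_neg 2 hq).const_mul (q / 3)).add
      ((integrableOn_pow_mul_exp_neg 1 hq).const_mul (1 / 3))).mul_prod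
      (integrableOn_pow_div_exp_sub_one 2)
    refine h.mono' (Measurable.aestronglyMeasurable (by simp only [hf]; fun_prop)) ?_
    rw [Measure.prod_restrict]
    refine (ae_restrict_iff' (measurableSet_Ioi.prod measurableSet_Ioi)).2
      (.of_forall fun z hz => ?_)
    obtain ⟨x, t⟩ := z
    obtain ⟨hx, ht⟩ : 0 < x ∧ 0 < t := hz
    have h0 := sub_sin_nonneg (mul_pos ht hx)
    have hE := hpos t ht
    simp only [Function.uncurry, hf]
    rw [Real.norm_of_nonneg (by positivity)]
    calc _ ≤ 2 * ((t * x) ^ 3 / 6) / (Real.exp (2 * π * t) - 1) *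
          (Real.exp (-(q * x)) * (q / x + 1 / x ^ 2)) := by
          gcongr; exact sub_sin_le (mul_pos ht hx)
      _ = _ := by simp only [Pi.add_apply]; field_simp; ring
  rw [← integral_neg]
  calc _ = ∫ t in Set.Ioi (0 : ℝ), ∫ x in Set.Ioi (0 : ℝ), f x t := by
        refine setIntegral_congr_fun measurableSet_Ioi fun t ht => ?_
        have hfe : ∀ x, f x t = 2 / (Real.exp (2 * π * t) - 1) *
            ((t * x - Real.sin (t * x)) * Real.exp (-(q * x)) * (q / x + 1 / x ^ 2)) :=
          fun x => by simp only [hf]; ring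
        simp only [hfe]
        rw [integral_const_mul, integral_sub_sin_mul_exp_neg hq ht]
        ring
    _ = ∫ x in Set.Ioi (0 : ℝ), ∫ t in Set.Ioi (0 : ℝ), f x t :=
        (integral_integral_swap hint).symm
    _ = _ := by
        refine setIntegral_congr_fun measurableSet_Ioi fun x hx => ?_
        simp only [hf]
        rw [integral_mul_const, bernoulliRemainder_eq_integral hx, integral_neg]
        ring

lemma integral_mul_log_div_exp_mul_sub_one {q : ℝ} (hq : 0 < q) :
    ∫ t in Set.Ioi (0 : ℝ), t * Real.log (1 + t ^ 2) / (Real.exp (2 * π * q * t) - 1) =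
      -(1 / q ^ 2) * ∫ x in Set.Ioi (0 : ℝ),
        bernoulliRemainder x * (Real.exp (-(q * x)) * (q / x + 1 / x ^ 2)) := by
  have h := integral_comp_mul_left_Ioi
    (fun t => t * Real.log (1 + t ^ 2 / q ^ 2) / (Real.exp (2 * π * t) - 1)) 0 hq
  rw [mul_zero, integral_mul_log_div_exp_sub_one hq] at h
  have h2 : ∀ t : ℝ, q * t * Real.log (1 + (q * t) ^ 2 / q ^ 2) / (Real.exp (2 * π * (q * t)) - 1) =
      q * (t * Real.log (1 + t ^ 2) / (Real.exp (2 * π * q * t) - 1)) := fun t => by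
    rw [mul_pow, mul_div_cancel_left₀ _ (by positivity), mul_assoc (2 * π)]
    ring
  simp only [h2, integral_const_mul, smul_eq_mul] at h
  refine mul_left_cancel₀ hq.ne' (h.trans ?_)
  rw [← mul_assoc, mul_neg, ← neg_mul]
  congr 1
  field_simp

lemma integral_exp_neg_mul_Ioi_zero {c : ℝ} (hc : 0 < c) :
    ∫ t in Set.Ioi (0 : ℝ), Real.exp (-(c * t)) = 1 / c := by
  have h := Real.integral_rpow_mul_exp_neg_mul_Ioi (a := 1) (r := c) one_pos hc
  simpa using h

lemma integral_sq_mul_exp_neg {c : ℝ} (hc : 0 < c) :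
    ∫ t in Set.Ioi (0 : ℝ), t ^ 2 * Real.exp (-(c * t)) = 2 / c ^ 3 := by
  have h := Real.integral_rpow_mul_exp_neg_mul_Ioi (a := 3) (r := c) three_pos hc
  have h3 : Real.Gamma 3 = 2 := by
    rw [show (3 : ℝ) = (2 : ℕ) + 1 by norm_num, Real.Gamma_nat_eq_factorial]
    rfl
  rw [h3] at h
  norm_num at h
  rw [h]
  ring

/-- The integral in Binet's first formula for `log Γ`. -/
noncomputable def binetIntegral (q : ℝ) : ℝ :=
  ∫ x in Set.Ioi (0 : ℝ), (bernoulliRemainder x + x / 12) * Real.exp (-(q * x)) / x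

lemma measurable_bernoulliRemainder : Measurable bernoulliRemainder := by
  unfold bernoulliRemainder
  fun_prop

lemma integrableOn_bernoulliRemainder_mul_exp_neg_div_pow {q : ℝ} (hq : 0 < q) {n : ℕ} (hn : n ≤ 3) :
    IntegrableOn (fun x => bernoulliRemainder x * Real.exp (-(q * x)) / x ^ n) (Set.Ioi 0) := by
  obtain ⟨C, -, hC⟩ := exists_abs_bernoulliRemainder_le
  have hm := measurable_bernoulliRemainder
  refine Integrable.mono' ((integrableOn_pow_mul_exp_neg (3 - n) hq).const_mul C)
    (Measurable.aestronglyMeasurable (by fun_prop))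
    ((ae_restrict_iff' measurableSet_Ioi).2 (.of_forall fun x hx => ?_))
  have hx : 0 < x := hx
  rw [norm_div, norm_mul, Real.norm_eq_abs, Real.norm_eq_abs, Real.abs_exp,
    Real.norm_of_nonneg (pow_pos hx n).le, div_le_iff₀ (pow_pos hx n)]
  calc _ ≤ C * x ^ 3 * Real.exp (-(q * x)) := by gcongr; exact hC x hx
    _ = _ := by rw [← Nat.sub_add_cancel hn, pow_add, Nat.add_sub_cancel]; ring

lemma integrableOn_bernoulliRemainder_mul_exp_neg_div {q : ℝ} (hq : 0 < q) :
    IntegrableOn (fun x => bernoulliRemainder x * Real.exp (-(q * x)) / x) (Set.Ioi 0) := by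
  simpa using integrableOn_bernoulliRemainder_mul_exp_neg_div_pow hq (n := 1) (by norm_num)

lemma binetIntegral_eq {q : ℝ} (hq : 0 < q) :
    binetIntegral q =
      (∫ x in Set.Ioi (0 : ℝ), bernoulliRemainder x * Real.exp (-(q * x)) / x) + 1 / (12 * q) := by
  have h1 : IntegrableOn (fun x => 1 / 12 * Real.exp (-(q * x))) (Set.Ioi 0) := by
    simpa [IntegrableOn] using (integrableOn_pow_mul_exp_neg 0 hq).const_mul (1 / 12)
  have h2 : 1 / (12 * q) = ∫ x in Set.Ioi (0 : ℝ), 1 / 12 * Real.exp (-(q * x)) := by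
    rw [integral_const_mul, integral_exp_neg_mul_Ioi_zero hq]; ring
  rw [h2, ← integral_add (integrableOn_bernoulliRemainder_mul_exp_neg_div hq) h1]
  refine setIntegral_congr_fun measurableSet_Ioi fun x hx => ?_
  have hx0 : x ≠ 0 := ne_of_gt hx
  field_simp

lemma integrableOn_binetIntegrand {q : ℝ} (hq : 0 < q) :
    IntegrableOn (fun x => (bernoulliRemainder x + x / 12) * Real.exp (-(q * x)) / x)
      (Set.Ioi 0) := by
  have h1 : IntegrableOn (fun x => 1 / 12 * Real.exp (-(q * x))) (Set.Ioi 0) := by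
    simpa [IntegrableOn] using (integrableOn_pow_mul_exp_neg 0 hq).const_mul (1 / 12)
  refine ((integrableOn_bernoulliRemainder_mul_exp_neg_div hq).add h1).congr_fun
    (fun x hx => ?_) measurableSet_Ioi
  have hx0 : x ≠ 0 := ne_of_gt hx
  simp only [Pi.add_apply]
  field_simp

lemma tendsto_binetIntegral : Filter.Tendsto binetIntegral Filter.atTop (nhds 0) := by
  obtain ⟨C, -, hC⟩ := exists_abs_bernoulliRemainder_le
  have hlim : Filter.Tendsto (fun q : ℝ => C * (2 / q ^ 3) + 1 / 12 * q⁻¹) Filter.atTop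
      (nhds (C * 0 + 1 / 12 * 0)) :=
    (((Filter.tendsto_pow_atTop three_ne_zero).const_div_atTop 2).const_mul C).add
      (tendsto_inv_atTop_zero.const_mul _)
  simp only [mul_zero, add_zero] at hlim
  refine squeeze_zero_norm' ?_ hlim
  filter_upwards [Filter.eventually_gt_atTop 0] with q hq
  rw [binetIntegral_eq hq]
  refine (norm_add_le _ _).trans (add_le_add ?_ (le_of_eq ?_))
  · rw [← integral_sq_mul_exp_neg hq, ← integral_const_mul]
    refine norm_integral_le_of_norm_le ((integrableOn_pow_mul_exp_neg 2 hq).const_mul C)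
      ((ae_restrict_iff' measurableSet_Ioi).2 (.of_forall fun x hx => ?_))
    have hx : 0 < x := hx
    rw [norm_div, norm_mul, Real.norm_eq_abs, Real.norm_eq_abs, Real.norm_eq_abs, Real.abs_exp,
      abs_of_pos hx, div_le_iff₀ hx]
    calc _ ≤ C * x ^ 3 * Real.exp (-(q * x)) := by gcongr; exact hC x hx
      _ = _ := by ring
  · rw [Real.norm_of_nonneg (by positivity)]; ring

lemma integral_sub_half_mul_exp_neg {x : ℝ} (hx : 0 < x) :
    ∫ u in Set.Ioc (0 : ℝ) 1, (u - 1 / 2) * Real.exp (-(u * x)) =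
      -((1 - Real.exp (-x)) * (bernoulliRemainder x + x / 12) / x) := by
  rw [← intervalIntegral.integral_of_le zero_le_one]
  have hd : ∀ u ∈ Set.uIcc (0 : ℝ) 1,
      HasDerivAt (fun u => -((u - 1 / 2) * Real.exp (-(u * x)) / x + Real.exp (-(u * x)) / x ^ 2))
        ((u - 1 / 2) * Real.exp (-(u * x))) u := fun u _ => by
    have he : HasDerivAt (fun u => Real.exp (-(u * x))) (Real.exp (-(u * x)) * -x) u := by
      refine HasDerivAt.exp ?_
      simpa using (hasDerivAt_id u).mul_const (-x)
    convert! (((((hasDerivAt_id u).sub_const (1 / 2)).mul he).div_const x).add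
      (he.div_const (x ^ 2))).neg using 1
    simp
    field_simp
    ring
  rw [intervalIntegral.integral_eq_sub_of_hasDerivAt hd
    (Continuous.intervalIntegrable (by fun_prop) _ _), bernoulliRemainder]
  have hne : 1 - Real.exp (-x) ≠ 0 := by
    have : Real.exp (-x) < 1 := by simpa using hx
    linarith
  simp only [zero_mul, one_mul, neg_zero, Real.exp_zero]
  generalize Real.exp (-x) = e at *
  field_simp
  ring

lemma integral_sub_half_div_add {q : ℝ} (hq : 0 < q) :
    ∫ u in Set.Ioc (0 : ℝ) 1, (u - 1 / 2) * (1 / (q + u)) =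
      1 - (q + 1 / 2) * (Real.log (q + 1) - Real.log q) := by
  rw [← intervalIntegral.integral_of_le zero_le_one]
  have hne : ∀ u ∈ Set.uIcc (0 : ℝ) 1, q + u ≠ 0 := fun u hu => by
    rw [Set.uIcc_of_le zero_le_one] at hu
    linarith [hu.1]
  have hd : ∀ u ∈ Set.uIcc (0 : ℝ) 1,
      HasDerivAt (fun u => u - (q + 1 / 2) * Real.log (q + u))
        ((u - 1 / 2) * (1 / (q + u))) u := fun u hu => by
    have := hne u hu
    convert! (hasDerivAt_id u).sub ((((hasDerivAt_id u).const_add q).log this).const_mul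
      (q + 1 / 2)) using 1
    simp only [id]
    field_simp
    ring
  rw [intervalIntegral.integral_eq_sub_of_hasDerivAt hd
    (ContinuousOn.intervalIntegrable (by fun_prop (disch := assumption)))]
  simp
  ring

lemma binetIntegral_sub_binetIntegral_add_one {q : ℝ} (hq : 0 < q) :
    binetIntegral q - binetIntegral (q + 1) =
      (q + 1 / 2) * (Real.log (q + 1) - Real.log q) - 1 := by
  have hq1 : 0 < q + 1 := by linarith
  have hint : Integrable (Function.uncurry fun x u : ℝ =>
      (u - 1 / 2) * Real.exp (-(u * x)) * Real.exp (-(q * x)))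
      ((volume.restrict (Set.Ioi 0)).prod (volume.restrict (Set.Ioc 0 1))) := by
    have h := (integrableOn_pow_mul_exp_neg 0 hq).mul_prod
      (integrableOn_const (μ := volume) (s := Set.Ioc (0 : ℝ) 1) (C := (1 : ℝ)) (by simp))
    refine h.mono' (Continuous.aestronglyMeasurable (by fun_prop)) ?_
    rw [Measure.prod_restrict]
    refine (ae_restrict_iff' (measurableSet_Ioi.prod measurableSet_Ioc)).2
      (.of_forall fun z hz => ?_)
    obtain ⟨x, u⟩ := z
    obtain ⟨hx, hu0, hu1⟩ : 0 < x ∧ 0 < u ∧ u ≤ 1 := hz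
    simp only [Function.uncurry, norm_mul, Real.norm_eq_abs, Real.abs_exp, pow_zero, one_mul,
      mul_one]
    refine mul_le_of_le_one_left (Real.exp_pos _).le
      (mul_le_one₀ (abs_le.2 ⟨by linarith, by linarith⟩) (Real.exp_pos _).le ?_)
    simp; positivity
  have hswap := integral_integral_swap hint
  have hR : ∫ u in Set.Ioc (0 : ℝ) 1, ∫ x in Set.Ioi (0 : ℝ),
      (u - 1 / 2) * Real.exp (-(u * x)) * Real.exp (-(q * x)) =
      1 - (q + 1 / 2) * (Real.log (q + 1) - Real.log q) := by
    rw [← integral_sub_half_div_add hq]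
    refine setIntegral_congr_fun measurableSet_Ioc fun u hu => ?_
    have hqu : 0 < q + u := by linarith [hu.1]
    simp only [mul_assoc, ← Real.exp_add]
    simp only [show ∀ x, -(u * x) + -(q * x) = -((q + u) * x) from fun x => by ring]
    rw [integral_const_mul, integral_exp_neg_mul_Ioi_zero hqu]
  rw [hR] at hswap
  rw [← neg_inj, neg_sub, neg_sub, ← hswap, binetIntegral, binetIntegral,
    ← integral_sub (integrableOn_binetIntegrand hq1) (integrableOn_binetIntegrand hq)]
  refine setIntegral_congr_fun measurableSet_Ioi fun x hx => ?_
  rw [integral_mul_const, integral_sub_half_mul_exp_neg hx,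
    show -((q + 1) * x) = -x + -(q * x) by ring, Real.exp_add]
  ring

lemma sum_log_add_eq {q : ℝ} (hq : 0 < q) (N : ℕ) :
    ∑ m ∈ Finset.range N, Real.log (q + m) =
      ((q + N - 1 / 2) * Real.log (q + N) - (q + N) + binetIntegral (q + N)) -
        ((q - 1 / 2) * Real.log q - q + binetIntegral q) := by
  induction N with
  | zero => simp
  | succ N ih =>
    have h := binetIntegral_sub_binetIntegral_add_one (q := q + N) (by positivity)
    rw [Finset.sum_range_succ, ih]
    push_cast
    rw [← add_assoc]
    linear_combination h

/-- **Binet's first formula** for `log Γ`. -/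
lemma log_Gamma_eq_binet {q : ℝ} (hq : 0 < q) :
    Real.log (Real.Gamma q) =
      (q - 1 / 2) * Real.log q - q + Real.log (√(2 * π)) + binetIntegral q := by
  have hm : Filter.Tendsto (fun n : ℕ => q + ((n + 1 : ℕ) : ℝ)) Filter.atTop Filter.atTop :=
    Filter.tendsto_atTop_add_const_left _ _
      (tendsto_natCast_atTop_atTop.comp (Filter.tendsto_add_atTop_nat 1))
  have hB := tendsto_binetIntegral.comp hm
  have h1 := (Real.tendsto_mul_log_one_add_div_atTop (-(q + 1))).comp hm
  have h2 : Filter.Tendsto (fun n : ℕ => Real.log (1 + -(q + 1) / (q + ((n + 1 : ℕ) : ℝ))))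
      Filter.atTop (nhds 0) := by
    have : Filter.Tendsto (fun n : ℕ => 1 + -(q + 1) / (q + ((n + 1 : ℕ) : ℝ)))
      Filter.atTop (nhds (1 + 0)) := (hm.const_div_atTop _).const_add 1
    simpa using this.log (by norm_num)
  have hst := Stirling.tendsto_stirlingSeq_sqrt_pi.log (Real.sqrt_ne_zero'.2 Real.pi_pos)
  have hlim := (((((hst.add h1).sub (h2.const_mul (1 / 2))).sub hB).add_const
    (1 / 2 * Real.log 2 + q + 1)).add_const ((q - 1 / 2) * Real.log q - q + binetIntegral q))
  have hG := Real.BohrMollerup.tendsto_log_gamma hq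
  have hval := tendsto_nhds_unique (hlim.congr' ?_) hG
  · rw [← hval, Real.log_sqrt Real.pi_pos.le, Real.log_sqrt (by positivity),
      Real.log_mul two_ne_zero Real.pi_ne_zero]
    ring
  · filter_upwards [Filter.eventually_gt_atTop 0] with n hn
    have hn' : (0 : ℝ) < n := by exact_mod_cast hn
    rw [Real.BohrMollerup.logGammaSeq, sum_log_add_eq hq, Stirling.log_stirlingSeq_formula]
    have hpos : 0 < q + ((n + 1 : ℕ) : ℝ) := by positivity
    have he : 1 + -(q + 1) / (q + ((n + 1 : ℕ) : ℝ)) = n / (q + ((n + 1 : ℕ) : ℝ)) := by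
      field_simp; push_cast; ring
    simp only [Function.comp]
    rw [he, Real.log_div hn'.ne' hpos.ne', Real.log_div hn'.ne' (Real.exp_pos 1).ne', Real.log_exp,
      Real.log_mul two_ne_zero hn'.ne']
    push_cast
    ring

lemma hasMellin_cpow_mul_exp_neg {q : ℝ} (hq : 0 < q) {s a : ℂ} (h : 0 < (s + a).re) :
    HasMellin (fun t : ℝ => (t : ℂ) ^ a • ((Real.exp (-(q * t)) : ℝ) : ℂ)) s
      ((q : ℂ) ^ (-(s + a)) * Complex.Gamma (s + a)) := by
  have hconv : MellinConvergent (fun t : ℝ => ((Real.exp (-t) : ℝ) : ℂ)) (s + a) := by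
    simpa only [MellinConvergent, smul_eq_mul, mul_comm] using Complex.GammaIntegral_convergent h
  refine ⟨MellinConvergent.cpow_smul.2
    ((MellinConvergent.comp_mul_left (f := fun t : ℝ => ((Real.exp (-t) : ℝ) : ℂ)) hq).2 hconv), ?_⟩
  rw [mellin_cpow_smul,
    mellin_comp_mul_left (fun t : ℝ => ((Real.exp (-t) : ℝ) : ℂ)) (s + a) hq, smul_eq_mul,
    Complex.Gamma_eq_integral h, Complex.GammaIntegral_eq_mellin]

/-- The Mellin transform of `bernoulliRemainder x * exp (-q x)`. -/
noncomputable def mellinBernoulliRemainder (q : ℝ) : ℂ → ℂ :=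
  mellin fun x : ℝ => ((bernoulliRemainder x * Real.exp (-(q * x)) : ℝ) : ℂ)

lemma locallyIntegrableOn_bernoulliRemainder_mul_exp_neg (q : ℝ) :
    LocallyIntegrableOn (fun x : ℝ => ((bernoulliRemainder x * Real.exp (-(q * x)) : ℝ) : ℂ))
      (Set.Ioi 0) := by
  refine ContinuousOn.locallyIntegrableOn ?_ measurableSet_Ioi
  exact Complex.continuous_ofReal.comp_continuousOn
    (continuousOn_bernoulliRemainder.mul (by fun_prop))

lemma isBigO_atTop_bernoulliRemainder_mul_exp_neg {q : ℝ} (hq : 0 < q) :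
    (fun x : ℝ => ((bernoulliRemainder x * Real.exp (-(q * x)) : ℝ) : ℂ)) =O[Filter.atTop]
      fun x => Real.exp (-(q / 2) * x) := by
  obtain ⟨C, -, hC⟩ := exists_abs_bernoulliRemainder_le
  have h1 : (fun x : ℝ => ((bernoulliRemainder x * Real.exp (-(q * x)) : ℝ) : ℂ)) =O[Filter.atTop]
      fun x => x ^ 3 * Real.exp (-(q * x)) := by
    refine Asymptotics.IsBigO.of_bound C ?_
    filter_upwards [Filter.eventually_gt_atTop 0] with x hx
    rw [Complex.norm_real, norm_mul, norm_mul, ← mul_assoc, Real.norm_of_nonneg (pow_nonneg hx.le 3)]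
    gcongr
    exact hC x hx
  have h2 := (isLittleO_pow_exp_pos_mul_atTop 3 (half_pos hq)).isBigO.mul
    (Asymptotics.isBigO_refl (fun x => Real.exp (-(q * x))) Filter.atTop)
  refine h1.trans (h2.congr_right fun x => ?_)
  rw [← Real.exp_add]
  ring_nf

lemma isBigO_zero_bernoulliRemainder_mul_exp_neg {q : ℝ} (hq : 0 < q) :
    (fun x : ℝ => ((bernoulliRemainder x * Real.exp (-(q * x)) : ℝ) : ℂ))
      =O[nhdsWithin 0 (Set.Ioi 0)] fun x => x ^ (-(-3 : ℝ)) := by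
  obtain ⟨C, hC0, hC⟩ := exists_abs_bernoulliRemainder_le
  refine Asymptotics.IsBigO.of_bound C ?_
  filter_upwards [self_mem_nhdsWithin] with x hx
  have hx : 0 < x := hx
  rw [neg_neg, show (3 : ℝ) = (3 : ℕ) by norm_num, Real.rpow_natCast, Complex.norm_real, norm_mul,
    Real.norm_of_nonneg (pow_nonneg hx.le 3), Real.norm_of_nonneg (Real.exp_pos _).le]
  refine (mul_le_of_le_one_right (norm_nonneg _) ?_).trans (hC x hx)
  simp; positivity

lemma differentiableAt_mellinBernoulliRemainder {q : ℝ} (hq : 0 < q) {s : ℂ} (hs : -3 < s.re) :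
    DifferentiableAt ℂ (mellinBernoulliRemainder q) s :=
  mellin_differentiableAt_of_isBigO_rpow_exp (half_pos hq)
    (locallyIntegrableOn_bernoulliRemainder_mul_exp_neg q)
    (isBigO_atTop_bernoulliRemainder_mul_exp_neg hq)
    (isBigO_zero_bernoulliRemainder_mul_exp_neg hq) hs

lemma mellin_exp_neg_div_one_sub_exp {q : ℝ} (hq : 0 < q) {s : ℂ} (hs : 1 < s.re) :
    mellin (fun x : ℝ => ((Real.exp (-(q * x)) / (1 - Real.exp (-x)) : ℝ) : ℂ)) s =
      (q : ℂ) ^ (1 - s) * Complex.Gamma (s - 1) + 1 / 2 * ((q : ℂ) ^ (-s) * Complex.Gamma s) +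
        1 / 12 * ((q : ℂ) ^ (-(s + 1)) * Complex.Gamma (s + 1)) +
        mellinBernoulliRemainder q s := by
  have h1 := hasMellin_cpow_mul_exp_neg hq (s := s) (a := -1) (by simpa using hs)
  have h2 := hasMellin_cpow_mul_exp_neg hq (s := s) (a := 0) (by simp; linarith)
  have h3 := hasMellin_cpow_mul_exp_neg hq (s := s) (a := 1) (by simp; linarith)
  have h4 : MellinConvergent
      (fun x : ℝ => ((bernoulliRemainder x * Real.exp (-(q * x)) : ℝ) : ℂ)) s :=
    mellinConvergent_of_isBigO_rpow_exp (half_pos hq)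
      (locallyIntegrableOn_bernoulliRemainder_mul_exp_neg q)
      (isBigO_atTop_bernoulliRemainder_mul_exp_neg hq)
      (isBigO_zero_bernoulliRemainder_mul_exp_neg hq) (by linarith)
  have h2' := hasMellin_const_smul h2.1 (1 / 2 : ℂ)
  have h3' := hasMellin_const_smul h3.1 (1 / 12 : ℂ)
  have h12 := hasMellin_add h1.1 h2'.1
  have h123 := hasMellin_add h12.1 h3'.1
  have h := (hasMellin_add h123.1 h4).2
  rw [h123.2, h12.2, h1.2, h2'.2, h2.2, h3'.2, h3.2] at h
  simp only [smul_eq_mul, add_zero, ← sub_eq_add_neg, neg_sub] at h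
  rw [mellinBernoulliRemainder, ← h]
  refine setIntegral_congr_fun measurableSet_Ioi fun x hx => ?_
  simp only [Complex.cpow_zero, Complex.cpow_one, Complex.cpow_neg_one, bernoulliRemainder]
  congr 1
  push_cast
  ring

lemma hasSum_hurwitz_mellin {q : ℝ} (hq : 0 < q) {s : ℂ} (hs : 1 < s.re) :
    HasSum (fun n : ℕ => Complex.Gamma s * ((n : ℂ) + (q : ℂ)) ^ (-s))
      (mellin (fun x : ℝ => ((Real.exp (-(q * x)) / (1 - Real.exp (-x)) : ℝ) : ℂ)) s) := by
  have hp : ∀ n : ℕ, 0 < (n : ℝ) + q := fun n => by positivity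
  have h := hasSum_mellin (a := fun _ : ℕ => 1) (p := fun n => (n : ℝ) + q)
    (F := fun x : ℝ => ((Real.exp (-(q * x)) / (1 - Real.exp (-x)) : ℝ) : ℂ)) (s := s)
    (fun n => Or.inr (hp n)) (by linarith) (fun t ht => ?_) ?_
  · convert! h using 2 with n
    rw [mul_one, Complex.cpow_neg]
    push_cast
    rw [div_eq_mul_inv]
  · have h1 : Real.exp (-t) < 1 := by simpa using ht
    have hg := (hasSum_geometric_of_lt_one (Real.exp_pos _).le h1).mul_left (Real.exp (-(q * t)))
    rw [← div_eq_mul_inv] at hg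
    convert! Complex.hasSum_ofReal.2 hg using 2 with n
    rw [one_mul, ← Real.exp_nat_mul, ← Real.exp_add]
    ring_nf
  · have h := (Real.summable_one_div_nat_add_rpow q s.re).2 hs
    refine h.congr fun n => ?_
    rw [abs_of_pos (hp n), norm_one]

lemma tsum_hurwitz_eq {q : ℝ} (hq : 0 < q) {s : ℂ} (hs : 1 < s.re) :
    ∑' n : ℕ, ((n : ℂ) + (q : ℂ)) ^ (-s) =
      (q : ℂ) ^ (1 - s) / (s - 1) + 1 / 2 * (q : ℂ) ^ (-s) +
        1 / 12 * (s * (q : ℂ) ^ (-(s + 1))) +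
        (Complex.Gamma s)⁻¹ * mellinBernoulliRemainder q s := by
  have h := (hasSum_hurwitz_mellin hq hs).tsum_eq
  rw [tsum_mul_left, mellin_exp_neg_div_one_sub_exp hq hs] at h
  have hG : Complex.Gamma s ≠ 0 := Complex.Gamma_ne_zero_of_re_pos (by linarith)
  have hs0 : s ≠ 0 := fun h0 => by simp [h0] at hs; linarith
  have hs1 : s - 1 ≠ 0 := fun h0 => by
    rw [sub_eq_zero.1 h0] at hs; simp at hs
  have hG1 : Complex.Gamma s = (s - 1) * Complex.Gamma (s - 1) := by
    simpa using Complex.Gamma_add_one (s - 1) hs1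
  rw [Complex.Gamma_add_one s hs0] at h
  refine mul_left_cancel₀ hG (h.trans ?_)
  have e1 : Complex.Gamma s * ((q : ℂ) ^ (1 - s) / (s - 1)) =
      (q : ℂ) ^ (1 - s) * Complex.Gamma (s - 1) := by
    rw [hG1]; field_simp
  rw [mul_add, mul_add, mul_add, e1, mul_inv_cancel_left₀ hG]
  ring

lemma eqOn_hurwitz {q : ℝ} (hq : 0 < q) {Z : ℂ → ℂ}
    (hZdiff : ∀ z : ℂ, z ≠ 1 → DifferentiableAt ℂ Z z)
    (hZser : ∀ z : ℂ, 1 < z.re → Z z = ∑' n : ℕ, ((n : ℂ) + (q : ℂ)) ^ (-z)) :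
    Set.EqOn Z (fun s => (q : ℂ) ^ (1 - s) / (s - 1) + 1 / 2 * (q : ℂ) ^ (-s) +
        1 / 12 * (s * (q : ℂ) ^ (-(s + 1))) +
        (Complex.Gamma s)⁻¹ * mellinBernoulliRemainder q s)
      {s | -3 < s.re ∧ s.re < 1} := by
  set A : Set ℂ := {s | 1 < s.re}
  set B : Set ℂ := {s | -3 < s.re} ∩ {s | 0 < s.im}
  set C : Set ℂ := {s | -3 < s.re} ∩ {s | s.re < 1}
  have hA : IsOpen A := isOpen_lt continuous_const Complex.continuous_re
  have hB : IsOpen B := (isOpen_lt continuous_const Complex.continuous_re).inter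
    (isOpen_lt continuous_const Complex.continuous_im)
  have hC : IsOpen C := (isOpen_lt continuous_const Complex.continuous_re).inter
    (isOpen_lt Complex.continuous_re continuous_const)
  have hU : IsOpen (A ∪ B ∪ C) := (hA.union hB).union hC
  have hpre : IsPreconnected (A ∪ B ∪ C) := by
    have hAB : IsPreconnected (A ∪ B) := IsPreconnected.union (2 + I) (by simp [A])
      (by simp [B]; norm_num) (convex_halfSpace_re_gt 1).isPreconnected
      ((convex_halfSpace_re_gt (-3)).inter (convex_halfSpace_im_gt 0)).isPreconnected
    exact IsPreconnected.union I (Or.inr (by simp [B])) (by simp [C]) hAB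
      ((convex_halfSpace_re_gt (-3)).inter (convex_halfSpace_re_lt 1)).isPreconnected
  have hmem : ∀ s ∈ A ∪ B ∪ C, s ≠ 1 ∧ -3 < s.re := by
    rintro s ((hs | hs) | hs)
    · exact ⟨fun h => by simp [A, h] at hs, by have : 1 < s.re := hs; linarith⟩
    · exact ⟨fun h => by simp [B, h] at hs, hs.1⟩
    · exact ⟨fun h => by simp [C, h] at hs, hs.1⟩
  have hq0 : (q : ℂ) ≠ 0 := by exact_mod_cast hq.ne'
  refine Set.EqOn.mono (s₂ := A ∪ B ∪ C) (fun s hs => Or.inr hs) ?_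
  refine AnalyticOnNhd.eqOn_of_preconnected_of_eventuallyEq (z₀ := 2)
    (DifferentiableOn.analyticOnNhd (fun s hs => (hZdiff s (hmem s hs).1).differentiableWithinAt) hU)
    (DifferentiableOn.analyticOnNhd (fun s hs => ?_) hU) hpre (Or.inl (Or.inl (by simp [A]))) ?_
  · have hs1 : s - 1 ≠ 0 := sub_ne_zero.2 (hmem s hs).1
    have hM := differentiableAt_mellinBernoulliRemainder hq (hmem s hs).2
    have hG : DifferentiableAt ℂ (fun s => (Complex.Gamma s)⁻¹) s :=
      Complex.differentiable_one_div_Gamma s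
    have hp : ∀ f : ℂ → ℂ, DifferentiableAt ℂ f s → DifferentiableAt ℂ (fun s => (q : ℂ) ^ f s) s :=
      fun f hf => hf.const_cpow (Or.inl hq0)
    have p1 := hp (fun s => 1 - s) (by fun_prop)
    have p2 := hp (fun s => -s) (by fun_prop)
    have p3 := hp (fun s => -(s + 1)) (by fun_prop)
    exact ((((p1.div (by fun_prop) hs1).add (p2.const_mul _)).add
      ((differentiableAt_id.mul p3).const_mul _)).add (hG.mul hM)).differentiableWithinAt
  · filter_upwards [hA.mem_nhds (show (2 : ℂ) ∈ A by simp [A])] with s hs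
    rw [hZser s hs, tsum_hurwitz_eq hq hs]

lemma mellinBernoulliRemainder_neg_one (q : ℝ) :
    mellinBernoulliRemainder q (-1) =
      ((∫ x in Set.Ioi (0 : ℝ), bernoulliRemainder x * Real.exp (-(q * x)) / x ^ 2 : ℝ) : ℂ) := by
  rw [mellinBernoulliRemainder, mellin, ← integral_complex_ofReal]
  refine setIntegral_congr_fun measurableSet_Ioi fun x hx => ?_
  simp only [smul_eq_mul]
  rw [show (-1 - 1 : ℂ) = -(2 : ℕ) by norm_num, Complex.cpow_neg, Complex.cpow_natCast]
  push_cast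
  ring

lemma deriv_hurwitz_neg_one {q : ℝ} (hq : 0 < q) {Z : ℂ → ℂ}
    (hZdiff : ∀ z : ℂ, z ≠ 1 → DifferentiableAt ℂ Z z)
    (hZser : ∀ z : ℂ, 1 < z.re → Z z = ∑' n : ℕ, ((n : ℂ) + (q : ℂ)) ^ (-z)) :
    deriv Z (-1) = (q : ℂ) ^ 2 * Real.log q / 2 - (q : ℂ) ^ 2 / 4 - q * Real.log q / 2 +
      (1 + Real.log q) / 12 - mellinBernoulliRemainder q (-1) := by
  have hq0 : (q : ℂ) ≠ 0 := by exact_mod_cast hq.ne'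
  have hev := (eqOn_hurwitz hq hZdiff hZser).eventuallyEq_of_mem
    (((isOpen_lt continuous_const Complex.continuous_re).inter
      (isOpen_lt Complex.continuous_re continuous_const)).mem_nhds
      (show (-1 : ℂ) ∈ {s : ℂ | -3 < s.re} ∩ {s : ℂ | s.re < 1} by simp))
  rw [hev.deriv_eq]
  have hlog : Complex.log q = (Real.log q : ℂ) := (Complex.ofReal_log hq.le).symm
  have hM := (differentiableAt_mellinBernoulliRemainder hq (s := -1) (by norm_num)).hasDerivAt
  have hG : DifferentiableAt ℂ (fun s => (Complex.Gamma (s + 1 + 1))⁻¹) (-1) :=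
    (Complex.differentiable_one_div_Gamma _).comp (-1 : ℂ)
      (f := fun s : ℂ => s + 1 + 1) (by fun_prop)
  have hid := hasDerivAt_id (-1 : ℂ)
  have hp : ∀ (f : ℂ → ℂ) (f' : ℂ), HasDerivAt f f' (-1) →
      HasDerivAt (fun s => (q : ℂ) ^ f s) ((q : ℂ) ^ f (-1) * Complex.log q * f') (-1) :=
    fun f f' hf => hf.const_cpow (Or.inl hq0)
  have p1 := (hp _ _ (hid.const_sub 1)).div (hid.sub_const 1) (by norm_num)
  have p2 := (hp _ _ hid.neg).const_mul (1 / 2 : ℂ)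
  have p3 := (hid.mul (hp _ _ (hid.add_const 1).neg)).const_mul (1 / 12 : ℂ)
  have p4 := (hid.mul ((hid.add_const 1).mul hG.hasDerivAt)).mul hM
  have hfun : (fun s : ℂ => (q : ℂ) ^ (1 - s) / (s - 1) + 1 / 2 * (q : ℂ) ^ (-s) +
        1 / 12 * (s * (q : ℂ) ^ (-(s + 1))) +
        (Complex.Gamma s)⁻¹ * mellinBernoulliRemainder q s) =
      fun s : ℂ => (q : ℂ) ^ (1 - s) / (s - 1) + 1 / 2 * (q : ℂ) ^ (-s) +
        1 / 12 * (s * (q : ℂ) ^ (-(s + 1))) +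
        (s * ((s + 1) * (Complex.Gamma (s + 1 + 1))⁻¹)) * mellinBernoulliRemainder q s := by
    funext s
    rw [Complex.one_div_Gamma_eq_self_mul_one_div_Gamma_add_one s,
      Complex.one_div_Gamma_eq_self_mul_one_div_Gamma_add_one (s + 1)]
  rw [hfun]
  refine ((((p1.add p2).add p3).add p4).deriv).trans ?_
  simp only [Pi.mul_apply, Pi.neg_apply, id, hlog]
  norm_num
  ring

lemma integral_bernoulliRemainder_mul_add {q : ℝ} (hq : 0 < q) :
    ∫ x in Set.Ioi (0 : ℝ), bernoulliRemainder x * (Real.exp (-(q * x)) * (q / x + 1 / x ^ 2)) =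
      q * (∫ x in Set.Ioi (0 : ℝ), bernoulliRemainder x * Real.exp (-(q * x)) / x) +
        ∫ x in Set.Ioi (0 : ℝ), bernoulliRemainder x * Real.exp (-(q * x)) / x ^ 2 := by
  rw [← integral_const_mul, ← integral_add
    ((integrableOn_bernoulliRemainder_mul_exp_neg_div hq).const_mul q)
    (integrableOn_bernoulliRemainder_mul_exp_neg_div_pow hq (n := 2) (by norm_num))]
  refine integral_congr_ae (.of_forall fun x => ?_)
  simp only
  ring

/-- `Z` plays the role of the Hurwitz zeta function `z ↦ ζ(z, q)`: it is differentiable away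
from the pole `z = 1` and agrees with the defining series for `Re z > 1`; by uniqueness of
analytic continuation this characterizes it. `deriv Z (-1)` is then `ζ'(-1, q)`. -/
theorem integral_L1 (q : ℝ) (hq : 0 < q) (Z : ℂ → ℂ)
    (hZdiff : ∀ z : ℂ, z ≠ 1 → DifferentiableAt ℂ Z z)
    (hZser : ∀ z : ℂ, 1 < z.re → Z z = ∑' n : ℕ, ((n : ℂ) + (q : ℂ)) ^ (-z)) :
    ((∫ t in Set.Ioi (0 : ℝ),
        t * Real.log (1 + t ^ 2) / (Real.exp (2 * π * q * t) - 1) : ℝ) : ℂ) =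
      (1 / (q : ℂ) ^ 2) * deriv Z (-1) - (Real.log (Real.Gamma q) : ℂ) / (q : ℂ) +
        (Real.log (Real.sqrt (2 * π)) : ℂ) / (q : ℂ) -
        (1 / (12 * (q : ℂ) ^ 2) - 1 / 2) * (Real.log q : ℂ) - 3 / 4 := by
  have hq0 : (q : ℂ) ≠ 0 := by exact_mod_cast hq.ne'
  have hB := log_Gamma_eq_binet hq
  rw [binetIntegral_eq hq] at hB
  rw [integral_mul_log_div_exp_mul_sub_one hq, integral_bernoulliRemainder_mul_add hq,
    deriv_hurwitz_neg_one hq hZdiff hZser, mellinBernoulliRemainder_neg_one, hB]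
  generalize ∫ x in Set.Ioi (0 : ℝ), bernoulliRemainder x * Real.exp (-(q * x)) / x = K
  generalize ∫ x in Set.Ioi (0 : ℝ), bernoulliRemainder x * Real.exp (-(q * x)) / x ^ 2 = M
  push_cast
  field_simp
  ring
end
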